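/- There exist constants c_A ≥ 1, N_0 and C, depending only on ξ, A, B, such that for all N ≥ N_0 the following holds. Let f satisfy condition (f) and assume ‖f‖ ≥ N^{-1/4}/√2. Then for any γ ≥ 1: P( x ∈ [A,B] : max_{1 ≤ M ≤ N} |Σ_{n=1}^{M} f(ξ x^{s_n})| ≥ 119 γ c_A ‖f‖^{1/4} √(N log log N) ) ≤ C ( exp(−γ ‖f‖^{-1/2} log log N) + N^{-3} ). -/

import Mathlib

open MeasureTheory Filter

/-- The `L²` norm of `f` over `[A,B]`. -/
noncomputable def fnorm (A B : ℝ) (f : ℝ → ℝ) : ℝ :=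
  Real.sqrt (∫ x in A..B, (f x) ^ 2)

/-- The natural logarithm, interpreted as `max {1, log x}`. -/
noncomputable def plog (x : ℝ) : ℝ := max 1 (Real.log x)

lemma ibp_bound {A B : ℝ} (hAB : A ≤ B) {u u' r r' : ℝ → ℝ} {Q : ℝ}
    (hu : ∀ x ∈ Set.Icc A B, HasDerivAt u (u' x) x) (hr : ∀ x ∈ Set.Icc A B, HasDerivAt r (r' x) x)
    (hu' : ContinuousOn u' (Set.Icc A B)) (hr' : ContinuousOn r' (Set.Icc A B))
    (hQ : ∀ x, |r x| ≤ Q) :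
    |∫ x in A..B, u x * r' x| ≤ Q * (|u A| + |u B| + ∫ x in A..B, |u' x|) := by
  have e := Set.uIcc_of_le hAB
  have hi : IntervalIntegrable u' volume A B := (by rw [e]; exact hu' : ContinuousOn u' (Set.uIcc A B)).intervalIntegrable
  have hi2 : IntervalIntegrable r' volume A B := (by rw [e]; exact hr' : ContinuousOn r' (Set.uIcc A B)).intervalIntegrable
  have hrc : ContinuousOn r (Set.uIcc A B) := by
    rw [e]; exact fun x hx => (hr x hx).continuousAt.continuousWithinAt
  rw [intervalIntegral.integral_mul_deriv_eq_deriv_mul (by rw [e]; exact hu) (by rw [e]; exact hr) hi hi2]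
  have h1 : |∫ x in A..B, u' x * r x| ≤ ∫ x in A..B, |u' x| * Q := by
    refine (intervalIntegral.abs_integral_le_integral_abs hAB).trans ?_
    refine intervalIntegral.integral_mono_on hAB (hi.mul_continuousOn hrc).abs (hi.abs.mul_const Q) ?_
    intro x hx
    rw [abs_mul]
    exact mul_le_mul_of_nonneg_left (hQ x) (abs_nonneg _)
  rw [intervalIntegral.integral_mul_const] at h1
  have h2 : |u B * r B| ≤ |u B| * Q := by
    rw [abs_mul]; exact mul_le_mul_of_nonneg_left (hQ B) (abs_nonneg _)
  have h3 : |u A * r A| ≤ |u A| * Q := by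
    rw [abs_mul]; exact mul_le_mul_of_nonneg_left (hQ A) (abs_nonneg _)
  rw [abs_le] at h1 h2 h3 ⊢
  constructor <;> nlinarith

lemma bdry_bound {A B : ℝ} (hAB : B - A = 1) {u u' : ℝ → ℝ}
    (hu : ∀ x ∈ Set.Icc A B, HasDerivAt u (u' x) x)
    (hu' : ContinuousOn u' (Set.Icc A B)) (c : ℝ) (hc : c ∈ Set.Icc A B) :
    |u B * (B - c) - u A * (A - c)| ≤ (∫ x in A..B, |u x|) + ∫ x in A..B, |u' x| := by
  have hle : A ≤ B := by linarith
  have e := Set.uIcc_of_le hle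
  have hi : IntervalIntegrable u' volume A B := (by rw [e]; exact hu' : ContinuousOn u' (Set.uIcc A B)).intervalIntegrable
  have huc : ContinuousOn u (Set.uIcc A B) := by
    rw [e]; exact fun x hx => (hu x hx).continuousAt.continuousWithinAt
  have hcc : ContinuousOn (fun x : ℝ => x - c) (Set.uIcc A B) := by fun_prop
  have hd : ∀ x ∈ Set.uIcc A B, HasDerivAt (fun x => u x * (x - c)) (u' x * (x - c) + u x * 1) x := by
    intro x hx
    rw [e] at hx
    exact (hu x hx).mul ((hasDerivAt_id x).sub_const c)
  have i1 : IntervalIntegrable (fun x => u' x * (x - c)) volume A B := hi.mul_continuousOn hcc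
  have i2 : IntervalIntegrable (fun x => u x * 1) volume A B := by
    simpa using huc.intervalIntegrable
  have key := intervalIntegral.integral_eq_sub_of_hasDerivAt hd (i1.add i2)
  rw [← key, ← intervalIntegral.integral_add (huc.intervalIntegrable.abs) hi.abs]
  refine (intervalIntegral.abs_integral_le_integral_abs hle).trans ?_
  refine intervalIntegral.integral_mono_on hle (i1.add i2).abs (huc.intervalIntegrable.abs.add hi.abs) ?_
  intro x hx
  have : |x - c| ≤ 1 := by
    rw [abs_le]; constructor <;> linarith [hx.1, hx.2, hc.1, hc.2]
  calc _ ≤ |u' x * (x - c)| + |u x * 1| := abs_add_le _ _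
    _ ≤ |u x| + |u' x| := by
      rw [abs_mul, mul_one]
      nlinarith [abs_nonneg (u' x)]

lemma ibp_bound2 {A B : ℝ} (hAB : B - A = 1) {u u' r r' : ℝ → ℝ} {Q : ℝ}
    (hu : ∀ x ∈ Set.Icc A B, HasDerivAt u (u' x) x) (hr : ∀ x ∈ Set.Icc A B, HasDerivAt r (r' x) x)
    (hu' : ContinuousOn u' (Set.Icc A B)) (hr' : ContinuousOn r' (Set.Icc A B))
    (hQ : ∀ x, |r x| ≤ Q) :
    |∫ x in A..B, u x * r' x| ≤ Q * (2 * (∫ x in A..B, |u x|) + 3 * ∫ x in A..B, |u' x|) := by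
  have hle : A ≤ B := by linarith
  have h := ibp_bound hle hu hr hu' hr' hQ
  have h1 := bdry_bound hAB hu hu' A ⟨le_rfl, hle⟩
  have h2 := bdry_bound hAB hu hu' B ⟨hle, le_rfl⟩
  have e : A - B = -1 := by linarith
  simp only [sub_self, mul_zero, sub_zero, hAB, mul_one, zero_sub, e, mul_neg, neg_neg] at h1 h2
  have hQ0 : 0 ≤ Q := (abs_nonneg _).trans (hQ 0)
  refine h.trans (mul_le_mul_of_nonneg_left ?_ hQ0)
  linarith

lemma antider {q : ℝ → ℝ} {Q : ℝ} (hc : Continuous q) (hp : ∀ x, q (x + 1) = q x)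
    (h0 : ∫ x in (0:ℝ)..1, q x = 0) (hQ : ∫ x in (0:ℝ)..1, |q x| ≤ Q) :
    (∀ y, HasDerivAt (fun y => ∫ x in (0:ℝ)..y, q x) (q y) y) ∧
    ∀ y, |∫ x in (0:ℝ)..y, q x| ≤ Q := by
  have hii : ∀ a b, IntervalIntegrable q volume a b := fun a b => hc.intervalIntegrable a b
  refine ⟨fun y => intervalIntegral.integral_hasDerivAt_right (hii _ _)
    (hc.stronglyMeasurableAtFilter _ _) hc.continuousAt, ?_⟩
  have hper : Function.Periodic (fun y => ∫ x in (0:ℝ)..y, q x) 1 := by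
    intro y
    have hp' : Function.Periodic q 1 := hp
    have := hp'.intervalIntegral_add_eq y 0
    simp only [zero_add, h0] at this
    change ∫ x in (0:ℝ)..(y+1), q x = ∫ x in (0:ℝ)..y, q x
    rw [← intervalIntegral.integral_add_adjacent_intervals (hii 0 y) (hii y (y+1)), this, add_zero]
  intro y
  obtain ⟨z, hz, hzy⟩ := hper.exists_mem_Ico₀ one_pos y
  replace hzy : (∫ x in (0:ℝ)..y, q x) = ∫ x in (0:ℝ)..z, q x := hzy
  rw [hzy]
  refine (intervalIntegral.abs_integral_le_integral_abs hz.1).trans (le_trans ?_ hQ)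
  exact intervalIntegral.integral_mono_interval le_rfl hz.1 hz.2.le
    (Eventually.of_forall fun x => abs_nonneg _) (hc.abs.intervalIntegrable _ _)

noncomputable def lam (ξ : ℝ) (s : ℕ) (x : ℝ) : ℝ := ξ * x ^ s
noncomputable def dlam (ξ : ℝ) (s : ℕ) (x : ℝ) : ℝ := ξ * (s * x ^ (s - 1))
noncomputable def phi (ξ : ℝ) (s : ℕ) (x : ℝ) : ℝ := (dlam ξ s x)⁻¹
noncomputable def dphi (ξ : ℝ) (s : ℕ) (x : ℝ) : ℝ :=
  - (ξ * (s * ((s - 1 : ℕ) * x ^ (s - 1 - 1)))) / (dlam ξ s x) ^ 2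

lemma hasDerivAt_lam (ξ : ℝ) (s : ℕ) (x : ℝ) : HasDerivAt (lam ξ s) (dlam ξ s x) x := by
  exact (hasDerivAt_pow s x).const_mul ξ

lemma dlam_pos {ξ : ℝ} (hξ : 0 < ξ) {s : ℕ} (hs : 1 ≤ s) {x : ℝ} (hx : 0 < x) : 0 < dlam ξ s x := by
  unfold dlam; positivity

lemma phi_pos {ξ : ℝ} (hξ : 0 < ξ) {s : ℕ} (hs : 1 ≤ s) {x : ℝ} (hx : 0 < x) : 0 < phi ξ s x :=
  inv_pos.2 (dlam_pos hξ hs hx)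

lemma continuous_dlam (ξ : ℝ) (s : ℕ) : Continuous (dlam ξ s) := by
  unfold dlam; fun_prop

lemma continuous_lam (ξ : ℝ) (s : ℕ) : Continuous (lam ξ s) := by
  unfold lam; fun_prop

lemma hasDerivAt_phi {ξ : ℝ} (hξ : 0 < ξ) {s : ℕ} (hs : 1 ≤ s) {x : ℝ} (hx : 0 < x) :
    HasDerivAt (phi ξ s) (dphi ξ s x) x := by
  have h1 : HasDerivAt (dlam ξ s) (ξ * (s * ((s - 1 : ℕ) * x ^ (s - 1 - 1)))) x :=
    ((hasDerivAt_pow (s-1) x).const_mul (s:ℝ)).const_mul ξ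
  exact h1.inv (dlam_pos hξ hs hx).ne'

lemma continuousOn_phi {ξ : ℝ} (hξ : 0 < ξ) {s : ℕ} (hs : 1 ≤ s) :
    ContinuousOn (phi ξ s) (Set.Ioi 0) :=
  (continuous_dlam ξ s).continuousOn.inv₀ fun _ hx => (dlam_pos hξ hs hx).ne'

lemma continuousOn_dphi {ξ : ℝ} (hξ : 0 < ξ) {s : ℕ} (hs : 1 ≤ s) :
    ContinuousOn (dphi ξ s) (Set.Ioi 0) := by
  unfold dphi
  refine ContinuousOn.div (by fun_prop) ((continuous_dlam ξ s).pow 2).continuousOn ?_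
  intro x hx
  exact pow_ne_zero _ (dlam_pos hξ hs hx).ne'

lemma phi_le {ξ : ℝ} (hξ : 0 < ξ) {s : ℕ} (hs : 1 ≤ s) {A x : ℝ} (hA : 1 < A) (hx : A ≤ x) :
    phi ξ s x ≤ (ξ * A ^ (s - 1))⁻¹ := by
  unfold phi dlam
  have : (1:ℝ) ≤ s := by exact_mod_cast hs
  have hA0 : 0 < A := by linarith
  have h2 : A ^ (s-1) ≤ x ^ (s-1) := by gcongr
  have h3 : 0 < A ^ (s-1) := by positivity
  apply inv_anti₀ (by positivity)
  apply mul_le_mul_of_nonneg_left _ hξ.le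
  nlinarith

lemma dphi_le {ξ : ℝ} (hξ : 0 < ξ) {s : ℕ} (hs : 1 ≤ s) {A x : ℝ} (hA : 1 < A) (hx : A ≤ x) :
    |dphi ξ s x| ≤ (ξ * A ^ (s - 1))⁻¹ := by
  have hx0 : 0 < x := by linarith
  have hd := dlam_pos hξ hs hx0
  have hA0 : 0 < A := by linarith
  have h2 : A ^ (s-1) ≤ x ^ (s-1) := by gcongr
  have h3 : 0 < A ^ (s-1) := by positivity
  refine le_trans ?_ (inv_anti₀ (by positivity) (mul_le_mul_of_nonneg_left h2 hξ.le))
  unfold dphi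
  rw [abs_div, abs_neg, abs_of_nonneg (by positivity), abs_of_pos (by positivity), div_le_iff₀ (by positivity)]
  unfold dlam
  obtain ⟨k, rfl⟩ : ∃ k, s = k + 1 := ⟨s - 1, by omega⟩
  simp only [Nat.add_sub_cancel]
  have hxk : 0 < x ^ k := by positivity
  rw [show (ξ * x ^ k)⁻¹ * (ξ * (((k+1:ℕ):ℝ) * x ^ k)) ^ 2 = ξ * ((k+1:ℕ):ℝ) * (((k+1:ℕ):ℝ) * x ^ k) by
    field_simp]
  rw [← mul_assoc]
  apply mul_le_mul_of_nonneg_left _ (by positivity)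
  have hk : (k:ℝ) ≤ ((k+1:ℕ):ℝ) := by push_cast; linarith
  have hk2 : x ^ (k-1) ≤ x ^ k := pow_le_pow_right₀ (by linarith) (by omega)
  exact mul_le_mul hk hk2 (by positivity) (by positivity)

lemma osc {A B ξ : ℝ} (hAB : B - A = 1) (s : ℕ) {u u' q : ℝ → ℝ} {Q : ℝ}
    (hu : ∀ x ∈ Set.Icc A B, HasDerivAt u (u' x) x)
    (hu' : ContinuousOn u' (Set.Icc A B))
    (hc : Continuous q) (hp : ∀ x, q (x + 1) = q x)
    (h0 : ∫ x in (0:ℝ)..1, q x = 0) (hQ : ∫ x in (0:ℝ)..1, |q x| ≤ Q) :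
    |∫ x in A..B, u x * (q (lam ξ s x) * dlam ξ s x)|
      ≤ Q * (2 * (∫ x in A..B, |u x|) + 3 * ∫ x in A..B, |u' x|) := by
  obtain ⟨h1, h2⟩ := antider hc hp h0 hQ
  refine ibp_bound2 (r := fun x => ∫ y in (0:ℝ)..(lam ξ s x), q y) hAB hu ?_ hu' ?_ ?_
  · intro x hx
    exact HasDerivAt.comp x (h1 (lam ξ s x)) (hasDerivAt_lam ξ s x)
  · have := continuous_lam ξ s
    have := continuous_dlam ξ s
    fun_prop
  · intro x; exact h2 _

/-- hypotheses on a weight `G` relative to exponent `s` with smallness `ε` -/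
structure Wt (A B ξ : ℝ) (G : ℝ → ℝ) (s : ℕ) (ε : ℝ) : Prop where
  hphi : ∀ x ∈ Set.Icc A B, phi ξ s x ≤ ε
  hdphi : ∀ x ∈ Set.Icc A B, |dphi ξ s x| ≤ ε
  hG : ∀ x ∈ Set.Icc A B, |deriv G x| * phi ξ s x ≤ ε * G x

section
variable {A B ξ : ℝ} {G : ℝ → ℝ} {s : ℕ} {ε : ℝ}

lemma Wt.du (hA : 1 < A) (hξ : 0 < ξ) (hs : 1 ≤ s) (hG : ContDiff ℝ 1 G) :
    (∀ x ∈ Set.Icc A B, HasDerivAt (fun x => G x * phi ξ s x) (deriv G x * phi ξ s x + G x * dphi ξ s x) x) ∧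
    ContinuousOn (fun x => deriv G x * phi ξ s x + G x * dphi ξ s x) (Set.Icc A B) := by
  have hsub : Set.Icc A B ⊆ Set.Ioi 0 := fun x hx => lt_of_lt_of_le (by linarith) hx.1
  constructor
  · intro x hx
    exact ((hG.differentiable (by norm_num)) x).hasDerivAt.mul (hasDerivAt_phi hξ hs (hsub hx))
  · have h1 := (continuousOn_phi hξ hs).mono hsub
    have h2 := (continuousOn_dphi hξ hs).mono hsub
    have h3 := hG.continuous_deriv le_rfl
    have h4 := hG.continuous
    exact (h3.continuousOn.mul h1).add (h4.continuousOn.mul h2)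

lemma Wt.int_u (w : Wt A B ξ G s ε) (hA : 1 < A) (hAB : A ≤ B) (hξ : 0 < ξ) (hs : 1 ≤ s) (hG : ContDiff ℝ 1 G)
    (hG0 : ∀ x, 0 ≤ G x) :
    (∫ x in A..B, |G x * phi ξ s x|) ≤ ε * ∫ x in A..B, G x := by
  have hsub : Set.Icc A B ⊆ Set.Ioi 0 := fun x hx => lt_of_lt_of_le (by linarith) hx.1
  have h1 := (continuousOn_phi hξ hs).mono hsub
  have h4 := hG.continuous
  rw [← intervalIntegral.integral_const_mul]
  refine intervalIntegral.integral_mono_on hAB ?_ ?_ ?_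
  · apply ContinuousOn.intervalIntegrable
    rw [Set.uIcc_of_le hAB]
    exact (h4.continuousOn.mul h1).abs
  · exact (h4.const_mul ε).intervalIntegrable _ _
  · intro x hx
    rw [abs_of_nonneg (mul_nonneg (hG0 x) (phi_pos hξ hs (hsub hx)).le), mul_comm]
    exact mul_le_mul_of_nonneg_right (w.hphi x hx) (hG0 x)

lemma Wt.int_du (w : Wt A B ξ G s ε) (hA : 1 < A) (hAB : A ≤ B) (hξ : 0 < ξ) (hs : 1 ≤ s) (hG : ContDiff ℝ 1 G)
    (hG0 : ∀ x, 0 ≤ G x) :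
    (∫ x in A..B, |deriv G x * phi ξ s x + G x * dphi ξ s x|) ≤ 2 * ε * ∫ x in A..B, G x := by
  have hsub : Set.Icc A B ⊆ Set.Ioi 0 := fun x hx => lt_of_lt_of_le (by linarith) hx.1
  have h4 := hG.continuous
  rw [← intervalIntegral.integral_const_mul]
  refine intervalIntegral.integral_mono_on hAB ?_ ?_ ?_
  · apply ContinuousOn.intervalIntegrable
    rw [Set.uIcc_of_le hAB]
    exact (Wt.du hA hξ hs hG).2.abs
  · exact (h4.const_mul _).intervalIntegrable _ _
  · intro x hx
    have h5 := w.hG x hx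
    have h6 := mul_le_mul_of_nonneg_left (w.hdphi x hx) (hG0 x)
    refine (abs_add_le _ _).trans ?_
    rw [abs_mul, abs_mul, abs_of_nonneg (hG0 x), abs_of_pos (phi_pos hξ hs (hsub hx))]
    linarith

lemma Wt.osc (w : Wt A B ξ G s ε) (hA : 1 < A) (hAB : B - A = 1) (hξ : 0 < ξ) (hs : 1 ≤ s) (hG : ContDiff ℝ 1 G)
    (hG0 : ∀ x, 0 ≤ G x) (t : ℕ) {q : ℝ → ℝ} {Q : ℝ}
    (hc : Continuous q) (hp : ∀ x, q (x + 1) = q x)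
    (h0 : ∫ x in (0:ℝ)..1, q x = 0) (hQ : ∫ x in (0:ℝ)..1, |q x| ≤ Q) :
    |∫ x in A..B, (G x * phi ξ s x) * (q (lam ξ t x) * dlam ξ t x)| ≤ 8 * Q * ε * ∫ x in A..B, G x := by
  obtain ⟨h1, h2⟩ := Wt.du (B := B) hA hξ hs hG
  have h3 := _root_.osc (ξ := ξ) hAB t h1 h2 hc hp h0 hQ
  have hle : A ≤ B := by linarith
  have h4 := w.int_u hA hle hξ hs hG hG0
  have h5 := w.int_du hA hle hξ hs hG hG0
  have hQ0 : 0 ≤ Q := le_trans (intervalIntegral.integral_nonneg zero_le_one fun _ _ => abs_nonneg _) hQ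
  refine h3.trans ?_
  calc _ ≤ Q * (2 * (ε * ∫ x in A..B, G x) + 3 * (2 * ε * ∫ x in A..B, G x)) := by gcongr
    _ = _ := by ring

lemma Wt.osc1 (w : Wt A B ξ G s ε) (hA : 1 < A) (hAB : B - A = 1) (hξ : 0 < ξ) (hs : 1 ≤ s) (hG : ContDiff ℝ 1 G)
    (hG0 : ∀ x, 0 ≤ G x) {q : ℝ → ℝ} {Q : ℝ}
    (hc : Continuous q) (hp : ∀ x, q (x + 1) = q x)
    (h0 : ∫ x in (0:ℝ)..1, q x = 0) (hQ : ∫ x in (0:ℝ)..1, |q x| ≤ Q) :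
    |∫ x in A..B, G x * q (lam ξ s x)| ≤ 8 * Q * ε * ∫ x in A..B, G x := by
  have h := w.osc hA hAB hξ hs hG hG0 s hc hp h0 hQ
  convert h using 2
  apply intervalIntegral.integral_congr
  intro x hx
  rw [Set.uIcc_of_le (by linarith)] at hx
  have hd := dlam_pos hξ hs (show 0 < x by linarith [hx.1])
  simp only [phi]
  field_simp

/-- non mean-zero version -/
lemma Wt.osc2 (w : Wt A B ξ G s ε) (hA : 1 < A) (hAB : B - A = 1) (hξ : 0 < ξ) (hs : 1 ≤ s) (hG : ContDiff ℝ 1 G)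
    (hG0 : ∀ x, 0 ≤ G x) (t : ℕ) {q : ℝ → ℝ} {Q : ℝ}
    (hc : Continuous q) (hp : ∀ x, q (x + 1) = q x) (hq : ∀ x, 0 ≤ q x)
    (hQ : ∫ x in (0:ℝ)..1, q x ≤ Q) {ρ : ℝ} (hρ : ∀ x ∈ Set.Icc A B, dlam ξ t x * phi ξ s x ≤ ρ) :
    (∫ x in A..B, (G x * phi ξ s x) * (q (lam ξ t x) * dlam ξ t x)) ≤ Q * (16 * ε + ρ) * ∫ x in A..B, G x := by
  have hle : A ≤ B := by linarith
  set μ := ∫ x in (0:ℝ)..1, q x with hμ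
  have hμ0 : 0 ≤ μ := intervalIntegral.integral_nonneg zero_le_one fun _ _ => hq _
  have hsub : Set.Icc A B ⊆ Set.Ioi 0 := fun x hx => lt_of_lt_of_le (by linarith) hx.1
  have c1 := (continuousOn_phi hξ hs).mono hsub
  have c2 := hG.continuous.continuousOn (s := Set.Icc A B)
  have c3 := (continuous_dlam ξ t).continuousOn (s := Set.Icc A B)
  have c4 := (hc.comp (continuous_lam ξ t)).continuousOn (s := Set.Icc A B)
  have h := w.osc hA hAB hξ hs hG hG0 t (q := fun x => q x - μ) (Q := 2 * μ) (by fun_prop) (by intro x; simp [hp])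
    (by rw [intervalIntegral.integral_sub (hc.intervalIntegrable _ _) (by simp)]; simp [hμ])
    (by
      calc _ ≤ ∫ x in (0:ℝ)..1, (q x + μ) := by
            refine intervalIntegral.integral_mono_on zero_le_one ?_ ?_ ?_
            · exact (by fun_prop : Continuous fun x => |q x - μ|).intervalIntegrable _ _
            · exact (by fun_prop : Continuous fun x => q x + μ).intervalIntegrable _ _
            · intro x _
              rw [abs_le]; constructor <;> linarith [hq x]
        _ = 2 * μ := by
            rw [intervalIntegral.integral_add (hc.intervalIntegrable _ _) (by simp)]; simp; linarith)
  have e : (∫ x in A..B, (G x * phi ξ s x) * (q (lam ξ t x) * dlam ξ t x)) =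
     (∫ x in A..B, (G x * phi ξ s x) * ((q (lam ξ t x) - μ) * dlam ξ t x)) + ∫ x in A..B, μ * (G x * (dlam ξ t x * phi ξ s x)) := by
    rw [← intervalIntegral.integral_add]
    · congr 1; ext x; ring
    · apply ContinuousOn.intervalIntegrable
      rw [Set.uIcc_of_le hle]
      exact (c2.mul c1).mul ((c4.sub continuousOn_const).mul c3)
    · apply ContinuousOn.intervalIntegrable
      rw [Set.uIcc_of_le hle]
      exact continuousOn_const.mul (c2.mul (c3.mul c1))
  have h2 : (∫ x in A..B, μ * (G x * (dlam ξ t x * phi ξ s x))) ≤ ∫ x in A..B, (μ * ρ) * G x := by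
    refine intervalIntegral.integral_mono_on hle ?_ ?_ ?_
    · apply ContinuousOn.intervalIntegrable
      rw [Set.uIcc_of_le hle]
      exact continuousOn_const.mul (c2.mul (c3.mul c1))
    · exact (hG.continuous.const_mul _).intervalIntegrable _ _
    · intro x hx
      have := mul_le_mul_of_nonneg_left (hρ x hx) (hG0 x)
      nlinarith
  rw [intervalIntegral.integral_const_mul (μ * ρ)] at h2
  have hI : 0 ≤ ∫ x in A..B, G x := intervalIntegral.integral_nonneg hle fun _ _ => hG0 _
  have hε : 0 ≤ ε := (abs_nonneg _).trans (w.hdphi A ⟨le_rfl, hle⟩)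
  have hρ0 : 0 ≤ ρ := le_trans (mul_nonneg (by unfold dlam; have : 0 < A := by linarith
                                               positivity) (phi_pos hξ hs (by linarith)).le) (hρ A ⟨le_rfl, hle⟩)
  rw [e]
  calc _ ≤ 8 * (2 * μ) * ε * (∫ x in A..B, G x) + μ * ρ * ∫ x in A..B, G x := add_le_add ((le_abs_self _).trans h) h2
    _ = μ * ((16 * ε + ρ) * ∫ x in A..B, G x) := by ring
    _ ≤ Q * ((16 * ε + ρ) * ∫ x in A..B, G x) := mul_le_mul_of_nonneg_right hQ (by positivity)
    _ = _ := by ring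

/-- properties of the smoothed function -/
structure Sm (g : ℝ → ℝ) : Prop where
  cd : ContDiff ℝ 1 g
  per : ∀ x, g (x + 1) = g x
  bd : ∀ x, |g x| ≤ 2
  mean : ∫ x in (0:ℝ)..1, g x = 0
  var : ∫ x in (0:ℝ)..1, |deriv g x| ≤ 4

lemma Wt.single (w : Wt A B ξ G s ε) (hA : 1 < A) (hAB : B - A = 1) (hξ : 0 < ξ) (hs : 1 ≤ s) (hG : ContDiff ℝ 1 G)
    (hG0 : ∀ x, 0 ≤ G x) {g : ℝ → ℝ} (hg : Sm g) :
    |∫ x in A..B, G x * g (lam ξ s x)| ≤ 16 * ε * ∫ x in A..B, G x := by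
  have h := w.osc1 hA hAB hξ hs hG hG0 hg.cd.continuous hg.per hg.mean (Q := 2) (by
    calc _ ≤ ∫ x in (0:ℝ)..1, (2:ℝ) := by
          refine intervalIntegral.integral_mono_on zero_le_one (hg.cd.continuous.abs.intervalIntegrable _ _) (by simp) ?_
          intro x _; exact hg.bd x
      _ = 2 := by simp)
  linarith

lemma Wt.sq (w : Wt A B ξ G s ε) (hA : 1 < A) (hAB : B - A = 1) (hξ : 0 < ξ) (hs : 1 ≤ s) (hG : ContDiff ℝ 1 G)
    (hG0 : ∀ x, 0 ≤ G x) {g : ℝ → ℝ} (hg : Sm g) {S : ℝ} (hS : ∫ x in (0:ℝ)..1, (g x) ^ 2 ≤ S) :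
    (∫ x in A..B, G x * (g (lam ξ s x)) ^ 2) ≤ S * (16 * ε + 1) * ∫ x in A..B, G x := by
  have hc := hg.cd.continuous
  have h := w.osc2 hA hAB hξ hs hG hG0 s (q := fun x => g x ^ 2) (by fun_prop) (by intro x; simp [hg.per])
    (fun x => sq_nonneg _) hS (ρ := 1) (by
      intro x hx
      exact (mul_inv_cancel₀ (dlam_pos hξ hs (show 0 < x by linarith [hx.1])).ne').le)
  refine le_trans (le_of_eq ?_) h
  apply intervalIntegral.integral_congr
  intro x hx
  rw [Set.uIcc_of_le (by linarith)] at hx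
  have hd := dlam_pos hξ hs (show 0 < x by linarith [hx.1])
  simp only [phi]
  field_simp

lemma Wt.pair (w : Wt A B ξ G s ε) (hA : 1 < A) (hAB : B - A = 1) (hξ : 0 < ξ) (hs : 1 ≤ s) (hG : ContDiff ℝ 1 G)
    (hG0 : ∀ x, 0 ≤ G x) {g : ℝ → ℝ} (hg : Sm g) (t : ℕ)
    {ρ : ℝ} (hρ : ∀ x ∈ Set.Icc A B, dlam ξ t x * phi ξ s x ≤ ρ) :
    |∫ x in A..B, G x * (g (lam ξ t x) * g (lam ξ s x))| ≤ 500 * (ε + ρ) * ∫ x in A..B, G x := by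
  have hle : A ≤ B := by linarith
  have hsub : Set.Icc A B ⊆ Set.Ioi 0 := fun x hx => lt_of_lt_of_le (by linarith) hx.1
  have hdc := hg.cd.continuous_deriv le_rfl
  have c1 := (continuousOn_phi hξ hs).mono hsub
  have c2 := hG.continuous.continuousOn (s := Set.Icc A B)
  have c3 := (continuous_dlam ξ t).continuousOn (s := Set.Icc A B)
  have c4 := (hdc.comp (continuous_lam ξ t)).continuousOn (s := Set.Icc A B)
  have c5 := (hg.cd.continuous.comp (continuous_lam ξ t)).continuousOn (s := Set.Icc A B)
  obtain ⟨h1, h2⟩ := Wt.du (B := B) hA hξ hs hG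
  have hQ : ∫ x in (0:ℝ)..1, |g x| ≤ 2 := by
    calc _ ≤ ∫ x in (0:ℝ)..1, (2:ℝ) := by
          refine intervalIntegral.integral_mono_on zero_le_one (hg.cd.continuous.abs.intervalIntegrable _ _) (by simp) ?_
          intro x _; exact hg.bd x
      _ = 2 := by simp
  have h3 := _root_.osc (ξ := ξ) hAB s (u := fun x => G x * phi ξ s x * g (lam ξ t x))
    (u' := fun x => (deriv G x * phi ξ s x + G x * dphi ξ s x) * g (lam ξ t x) +
       (G x * phi ξ s x) * (deriv g (lam ξ t x) * dlam ξ t x)) (by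
      intro x hx
      exact (h1 x hx).mul (HasDerivAt.comp x ((hg.cd.differentiable (by norm_num)) _).hasDerivAt (hasDerivAt_lam ξ t x)))
      ((h2.mul c5).add ((c2.mul c1).mul (c4.mul c3))) hg.cd.continuous hg.per hg.mean hQ
  have e : (∫ x in A..B, G x * (g (lam ξ t x) * g (lam ξ s x))) =
      ∫ x in A..B, (G x * phi ξ s x * g (lam ξ t x)) * (g (lam ξ s x) * dlam ξ s x) := by
    apply intervalIntegral.integral_congr
    intro x hx
    rw [Set.uIcc_of_le (by linarith)] at hx
    have hd := dlam_pos hξ hs (show 0 < x by linarith [hx.1])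
    simp only [phi]
    field_simp
  rw [e]
  have h4 := w.int_u hA hle hξ hs hG hG0
  have h5 := w.int_du hA hle hξ hs hG hG0
  have hperd : ∀ x, deriv g (x + 1) = deriv g x := by
    intro x
    rw [← deriv_comp_add_const]
    congr 1; ext y; exact hg.per y
  have h6 := w.osc2 hA hAB hξ hs hG hG0 t (q := fun x => |deriv g x|) hdc.abs (by intro x; simp [hperd])
    (fun x => abs_nonneg _) hg.var hρ
  have cI : ∀ {k : ℝ → ℝ}, ContinuousOn k (Set.Icc A B) → IntervalIntegrable k volume A B := by
    intro k hk; apply ContinuousOn.intervalIntegrable; rwa [Set.uIcc_of_le hle]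
  have h7 : (∫ x in A..B, |G x * phi ξ s x * g (lam ξ t x)|) ≤ 2 * ∫ x in A..B, |G x * phi ξ s x| := by
    rw [← intervalIntegral.integral_const_mul]
    refine intervalIntegral.integral_mono_on hle (cI ((c2.mul c1).mul c5).abs) (cI (continuousOn_const.mul (c2.mul c1).abs)) ?_
    intro x hx
    rw [abs_mul, mul_comm]
    exact mul_le_mul_of_nonneg_right (hg.bd _) (abs_nonneg _)
  have h8 : (∫ x in A..B, |(deriv G x * phi ξ s x + G x * dphi ξ s x) * g (lam ξ t x) +
       (G x * phi ξ s x) * (deriv g (lam ξ t x) * dlam ξ t x)|) ≤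
       2 * (∫ x in A..B, |deriv G x * phi ξ s x + G x * dphi ξ s x|) +
       ∫ x in A..B, (G x * phi ξ s x) * (|deriv g (lam ξ t x)| * dlam ξ t x) := by
    have i1 : IntervalIntegrable (fun x => 2 * |deriv G x * phi ξ s x + G x * dphi ξ s x|) volume A B :=
      cI (continuousOn_const.mul h2.abs)
    have i2 : IntervalIntegrable (fun x => (G x * phi ξ s x) * (|deriv g (lam ξ t x)| * dlam ξ t x)) volume A B :=
      cI ((c2.mul c1).mul (c4.abs.mul c3))
    rw [← intervalIntegral.integral_const_mul, ← intervalIntegral.integral_add i1 i2]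
    refine intervalIntegral.integral_mono_on hle (cI ((h2.mul c5).add ((c2.mul c1).mul (c4.mul c3))).abs)
      (i1.add i2) ?_
    intro x hx
    refine (abs_add_le _ _).trans (add_le_add ?_ (le_of_eq ?_))
    · rw [abs_mul, mul_comm]
      exact mul_le_mul_of_nonneg_right (hg.bd _) (abs_nonneg _)
    · have hx0 : 0 < x := hsub hx
      have hp := phi_pos hξ hs hx0
      have hd : 0 ≤ dlam ξ t x := by unfold dlam; positivity
      rw [abs_mul, abs_mul, abs_mul, abs_of_nonneg (hG0 x), abs_of_pos hp, abs_of_nonneg hd]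
  have hI : 0 ≤ ∫ x in A..B, G x := intervalIntegral.integral_nonneg hle fun _ _ => hG0 _
  have hε : 0 ≤ ε := (abs_nonneg _).trans (w.hdphi A ⟨le_rfl, hle⟩)
  have hρ0 : 0 ≤ ρ := le_trans (mul_nonneg (by unfold dlam; have : 0 < A := by linarith
                                               positivity) (phi_pos hξ hs (by linarith)).le) (hρ A ⟨le_rfl, hle⟩)
  have hεI := mul_nonneg hε hI
  have hρI := mul_nonneg hρ0 hI
  nlinarith
end

lemma geom_two {θ : ℝ} (h0 : 0 ≤ θ) (h1 : θ < 1) (L r : ℕ) :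
    ∑ j ∈ Finset.range L, θ ^ ((r - j) + (j - r)) ≤ 2 / (1 - θ) := by
  have hg : ∀ n, ∑ j ∈ Finset.range n, θ ^ j ≤ 1 / (1 - θ) := by
    intro n
    have := (hasSum_geometric_of_lt_one h0 h1)
    rw [one_div, ← this.tsum_eq]
    exact this.summable.sum_le_tsum _ (fun i _ => pow_nonneg h0 i)
  calc _ ≤ ∑ j ∈ Finset.range ((r + 1) + L), θ ^ ((r - j) + (j - r)) := by
        apply Finset.sum_le_sum_of_subset_of_nonneg
        · intro x; simp; omega
        · intros; positivity
    _ = ∑ j ∈ Finset.range (r + 1), θ ^ ((r - j) + (j - r)) + ∑ j ∈ Finset.range L, θ ^ ((r - (r + 1 + j)) + ((r + 1 + j) - r)) :=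
        Finset.sum_range_add _ _ _
    _ ≤ ∑ j ∈ Finset.range (r + 1), θ ^ j + ∑ j ∈ Finset.range L, θ ^ j := by
        apply add_le_add
        · rw [← Finset.sum_range_reflect (fun j => θ ^ j)]
          apply le_of_eq
          apply Finset.sum_congr rfl
          intro j hj
          rw [Finset.mem_range] at hj
          congr 1; omega
        · apply Finset.sum_le_sum
          intro j _
          apply pow_le_pow_of_le_one h0 h1.le; omega
    _ ≤ 1 / (1 - θ) + 1 / (1 - θ) := add_le_add (hg _) (hg _)
    _ = _ := by ring

lemma dlam_phi_le {A ξ : ℝ} (hA : 1 < A) (hξ : 0 < ξ) {p s d : ℕ} (hp : p + d ≤ s) (hs : 1 ≤ s) {x : ℝ} (hx : A ≤ x) :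
    dlam ξ p x * phi ξ s x ≤ (A ^ d)⁻¹ := by
  have hx0 : 0 < x := by linarith
  have hA0 : 0 < A := by linarith
  unfold phi
  rw [← div_eq_mul_inv, div_le_iff₀ (dlam_pos hξ hs hx0)]
  rcases Nat.eq_zero_or_pos p with rfl | hp0
  · simp [dlam]; positivity
  unfold dlam
  have h1 : x ^ (s - 1) = x ^ (p - 1) * x ^ (s - p) := by
    rw [← pow_add]; congr 1; omega
  have h2 : A ^ d ≤ x ^ (s - p) := (pow_le_pow_left₀ hA0.le hx d).trans (pow_le_pow_right₀ (by linarith) (by omega))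
  have h3 : 1 ≤ (A ^ d)⁻¹ * x ^ (s - p) := by
    rw [inv_mul_eq_div, one_le_div (by positivity)]; exact h2
  have h4 : (p:ℝ) ≤ s := by exact_mod_cast (by omega : p ≤ s)
  rw [h1]
  calc ξ * (p * x ^ (p-1)) ≤ ξ * (s * x ^ (p-1)) * 1 := by rw [mul_one]; gcongr
    _ ≤ ξ * (s * x ^ (p-1)) * ((A ^ d)⁻¹ * x ^ (s - p)) := by gcongr
    _ = _ := by ring

lemma Wt.mono {A B ξ : ℝ} {G : ℝ → ℝ} {s : ℕ} {ε ε' : ℝ} (w : Wt A B ξ G s ε) (h : ε ≤ ε') (hG0 : ∀ x, 0 ≤ G x) :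
    Wt A B ξ G s ε' :=
  ⟨fun x hx => (w.hphi x hx).trans h, fun x hx => (w.hdphi x hx).trans h,
   fun x hx => (w.hG x hx).trans (mul_le_mul_of_nonneg_right h (hG0 x))⟩

lemma block_pair {A B ξ : ℝ} (hA : 1 < A) (hAB : B - A = 1) (hξ : 0 < ξ) {G : ℝ → ℝ} (hG : ContDiff ℝ 1 G)
    (hG0 : ∀ x, 0 ≤ G x) {g : ℝ → ℝ} (hg : Sm g) {τ : ℝ} (hτ0 : 0 ≤ τ)
    (hS : ∫ x in (0:ℝ)..1, (g x) ^ 2 ≤ τ ^ 2) {e : ℕ → ℕ} (he : StrictMono e) (he1 : ∀ r, 1 ≤ e r)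
    {δ : ℝ} (hδ : 0 ≤ δ) (hδ1 : δ ≤ 1) {r r' : ℕ} (hr : r ≤ r')
    (w : Wt A B ξ G (e r) (δ * (A ^ r)⁻¹)) (w' : Wt A B ξ G (e r') (δ * (A ^ r')⁻¹)) 
    {θ : ℝ} (hθ0 : 0 ≤ θ) (hθ : θ ^ 2 = A⁻¹) :
    |∫ x in A..B, G x * (g (lam ξ (e r) x) * g (lam ξ (e r') x))| ≤ 131 * τ * θ ^ (r' - r) * ∫ x in A..B, G x := by
  have hle : A ≤ B := by linarith
  have hA0 : 0 < A := by linarith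
  have hI : 0 ≤ ∫ x in A..B, G x := intervalIntegral.integral_nonneg hle fun _ _ => hG0 _
  have hpow : ∀ n : ℕ, (A ^ n)⁻¹ ≤ 1 := fun n => inv_le_one_of_one_le₀ (one_le_pow₀ hA.le)
  have cont : ∀ n, Continuous fun x => g (lam ξ n x) := fun n => hg.cd.continuous.comp (continuous_lam ξ n)
  have sq : ∀ {k}, Wt A B ξ G (e k) (δ * (A ^ k)⁻¹) → (∫ x in A..B, G x * (g (lam ξ (e k) x)) ^ 2) ≤ 17 * τ ^ 2 * ∫ x in A..B, G x := by
    intro k wk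
    have := (wk.mono (mul_le_of_le_one_right hδ (hpow k)) hG0).sq hA hAB hξ (he1 k) hG hG0 hg hS
    refine this.trans (mul_le_mul_of_nonneg_right ?_ hI)
    nlinarith [sq_nonneg τ]
  have b1 : |∫ x in A..B, G x * (g (lam ξ (e r) x) * g (lam ξ (e r') x))| ≤ 17 * τ ^ 2 * ∫ x in A..B, G x := by
    have i1 : ∀ k, IntervalIntegrable (fun x => G x * (g (lam ξ (e k) x)) ^ 2) volume A B := fun k =>
      (hG.continuous.mul ((cont (e k)).pow 2)).intervalIntegrable _ _
    have h : |∫ x in A..B, G x * (g (lam ξ (e r) x) * g (lam ξ (e r') x))| ≤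
        ∫ x in A..B, (1/2:ℝ) * (G x * (g (lam ξ (e r) x)) ^ 2 + G x * (g (lam ξ (e r') x)) ^ 2) := by
      refine (intervalIntegral.abs_integral_le_integral_abs hle).trans ?_
      refine intervalIntegral.integral_mono_on hle ?_ (((i1 r).add (i1 r')).const_mul _) ?_
      · exact (hG.continuous.mul ((cont (e r)).mul (cont (e r')))).abs.intervalIntegrable _ _
      · intro x _
        rw [abs_mul, abs_of_nonneg (hG0 x), ← mul_add, mul_left_comm]
        apply mul_le_mul_of_nonneg_left _ (hG0 x)
        rw [abs_le]; constructor <;> nlinarith [sq_nonneg (g (lam ξ (e r) x) + g (lam ξ (e r') x)), sq_nonneg (g (lam ξ (e r) x) - g (lam ξ (e r') x))]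
    rw [intervalIntegral.integral_const_mul, intervalIntegral.integral_add (i1 r) (i1 r')] at h
    linarith [sq w, sq w']
  have b2 : |∫ x in A..B, G x * (g (lam ξ (e r) x) * g (lam ξ (e r') x))| ≤ 1000 * (θ ^ (r' - r)) ^ 2 * ∫ x in A..B, G x := by
    have := w'.pair hA hAB hξ (he1 r') hG hG0 hg (e r) (ρ := (A ^ (r' - r))⁻¹) (by
      intro x hx
      have : ∀ d, e r + d ≤ e (r + d) := by
        intro d
        induction d with
        | zero => simp
        | succ d ih => 
          have := he (show r + d < r + (d + 1) by omega)
          omega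
      have h2 := this (r' - r)
      rw [show r + (r' - r) = r' by omega] at h2
      exact dlam_phi_le hA hξ h2 (he1 r') hx.1)
    refine this.trans (mul_le_mul_of_nonneg_right ?_ hI)
    rw [← pow_mul, mul_comm _ 2, pow_mul, hθ, inv_pow]
    have h3 : (A ^ r')⁻¹ ≤ (A ^ (r' - r))⁻¹ := inv_anti₀ (by positivity) (pow_le_pow_right₀ hA.le (by omega))
    have h4 : 0 ≤ (A ^ r')⁻¹ := by positivity
    nlinarith
  set X := |∫ x in A..B, G x * (g (lam ξ (e r) x) * g (lam ξ (e r') x))|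
  set I := ∫ x in A..B, G x
  set y := θ ^ (r' - r)
  have hy : 0 ≤ y := by positivity
  have hX : 0 ≤ X := abs_nonneg _
  refine le_of_sq_le_sq ?_ (by positivity)
  calc X ^ 2 = X * X := by ring
    _ ≤ (17 * τ ^ 2 * I) * (1000 * y ^ 2 * I) := by gcongr
    _ ≤ _ := by nlinarith [sq_nonneg (τ * y * I)]

lemma block {A B ξ : ℝ} (hA : 1 < A) (hAB : B - A = 1) (hξ : 0 < ξ) {G : ℝ → ℝ} (hG : ContDiff ℝ 1 G)
    (hG0 : ∀ x, 0 ≤ G x) {g : ℝ → ℝ} (hg : Sm g) {τ : ℝ} (hτ0 : 0 ≤ τ)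
    (hS : ∫ x in (0:ℝ)..1, (g x) ^ 2 ≤ τ ^ 2) {e : ℕ → ℕ} (he : StrictMono e) (he1 : ∀ r, 1 ≤ e r)
    {δ : ℝ} (hδ : 0 ≤ δ) (hδ1 : δ ≤ 1) {L : ℕ}
    (w : ∀ r < L, Wt A B ξ G (e r) (δ * (A ^ r)⁻¹))
    {θ : ℝ} (hθ0 : 0 ≤ θ) (hθ1 : θ < 1) (hθ : θ ^ 2 = A⁻¹) {κ : ℝ} (hκ : 0 ≤ κ) (hκL : κ * (2 * L) ≤ 1)
    (hδκ : δ ≤ κ * τ) :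
    (∫ x in A..B, G x * Real.exp (κ * ∑ r ∈ Finset.range L, g (lam ξ (e r) x))) ≤
      Real.exp ((16 + 262 / (1 - θ)) * (κ ^ 2 * τ * L)) * ∫ x in A..B, G x := by
  have hle : A ≤ B := by linarith
  have hA0 : 0 < A := by linarith
  have hI : 0 ≤ ∫ x in A..B, G x := intervalIntegral.integral_nonneg hle fun _ _ => hG0 _
  have hpow : ∀ n : ℕ, (A ^ n)⁻¹ ≤ 1 := fun n => inv_le_one_of_one_le₀ (one_le_pow₀ hA.le)
  have cont : ∀ n, Continuous fun x => g (lam ξ n x) := fun n => hg.cd.continuous.comp (continuous_lam ξ n)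
  have hGc := hG.continuous
  set U : ℝ → ℝ := fun x => ∑ r ∈ Finset.range L, g (lam ξ (e r) x) with hU
  have hUc : Continuous U := continuous_finsetSum _ fun r _ => cont (e r)
  have hUb : ∀ x, |U x| ≤ 2 * L := by
    intro x
    refine (Finset.abs_sum_le_sum_abs _ _).trans ?_
    refine (Finset.sum_le_sum fun r _ => hg.bd _).trans ?_
    simp [mul_comm]
  have m1 : (∫ x in A..B, G x * U x) ≤ 16 * δ * L * ∫ x in A..B, G x := by
    simp only [hU, Finset.mul_sum]
    have ii : ∀ r, IntervalIntegrable (fun x => G x * g (lam ξ (e r) x)) volume A B := fun r =>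
      (hGc.mul (cont (e r))).intervalIntegrable _ _
    rw [intervalIntegral.integral_finsetSum fun r _ => ii r]
    calc _ ≤ ∑ r ∈ Finset.range L, 16 * δ * ∫ x in A..B, G x := by
          apply Finset.sum_le_sum
          intro r hr
          have hr' := Finset.mem_range.1 hr
          exact (le_abs_self _).trans (((w r hr').mono (mul_le_of_le_one_right hδ (hpow r)) hG0).single hA hAB hξ (he1 r) hG hG0 hg)
      _ = _ := by simp; ring
  have m2 : (∫ x in A..B, G x * U x ^ 2) ≤ 131 * τ * (2 / (1 - θ)) * L * ∫ x in A..B, G x := by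
    have : ∀ x, G x * U x ^ 2 = ∑ r ∈ Finset.range L, ∑ r' ∈ Finset.range L, G x * (g (lam ξ (e r) x) * g (lam ξ (e r') x)) := by
      intro x
      simp only [hU]
      rw [sq, Finset.sum_mul_sum, Finset.mul_sum]
      simp only [Finset.mul_sum]
    simp only [this]
    have ii : ∀ r r', IntervalIntegrable (fun x => G x * (g (lam ξ (e r) x) * g (lam ξ (e r') x))) volume A B := fun r r' =>
      (hGc.mul ((cont _).mul (cont _))).intervalIntegrable _ _
    have ii2 : ∀ r, IntervalIntegrable (fun x => ∑ r' ∈ Finset.range L, G x * (g (lam ξ (e r) x) * g (lam ξ (e r') x))) volume A B := fun r =>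
      (continuous_finsetSum _ fun r' _ => (hGc.mul ((cont (e r)).mul (cont (e r'))))).intervalIntegrable _ _
    rw [intervalIntegral.integral_finsetSum fun r _ => ii2 r]
    calc _ ≤ ∑ r ∈ Finset.range L, 131 * τ * (2 / (1 - θ)) * ∫ x in A..B, G x := by
          apply Finset.sum_le_sum
          intro r hr
          rw [intervalIntegral.integral_finsetSum fun r' _ => ii r r']
          calc _ ≤ ∑ r' ∈ Finset.range L, (131 * τ * ∫ x in A..B, G x) * θ ^ ((r - r') + (r' - r)) := by
                apply Finset.sum_le_sum
                intro r' hr'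
                rw [Finset.mem_range] at hr hr'
                rcases le_total r r' with h | h
                · have := block_pair hA hAB hξ hG hG0 hg hτ0  hS he he1 hδ hδ1 h (w r hr) (w r' hr') hθ0 hθ
                  rw [Nat.sub_eq_zero_of_le h, zero_add]
                  refine (le_abs_self _).trans (this.trans (le_of_eq (by ring)))
                · have := block_pair hA hAB hξ hG hG0 hg hτ0  hS he he1 hδ hδ1 h (w r' hr') (w r hr) hθ0 hθ
                  rw [Nat.sub_eq_zero_of_le h, add_zero]
                  simp only [mul_comm (g (lam ξ (e r) _))]
                  refine (le_abs_self _).trans (this.trans (le_of_eq (by ring)))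
            _ ≤ (131 * τ * ∫ x in A..B, G x) * (2 / (1 - θ)) := by
                rw [← Finset.mul_sum]
                exact mul_le_mul_of_nonneg_left (geom_two hθ0 hθ1 L r) (by positivity)
            _ = _ := by ring
      _ = _ := by simp; ring
  have hexp : ∀ x, Real.exp (κ * U x) ≤ 1 + κ * U x + κ ^ 2 * U x ^ 2 := by
    intro x
    have h1 : |κ * U x| ≤ 1 := by
      rw [abs_mul, abs_of_nonneg hκ]
      exact (mul_le_mul_of_nonneg_left (hUb x) hκ).trans hκL
    have := (abs_le.1 (Real.abs_exp_sub_one_sub_id_le h1)).2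
    nlinarith
  have i0 : IntervalIntegrable G volume A B := hGc.intervalIntegrable _ _
  have i1 : IntervalIntegrable (fun x => κ * (G x * U x)) volume A B := (continuous_const.mul (hGc.mul hUc)).intervalIntegrable _ _
  have i2 : IntervalIntegrable (fun x => κ ^ 2 * (G x * U x ^ 2)) volume A B := (continuous_const.mul (hGc.mul (hUc.pow 2))).intervalIntegrable _ _
  have h1 : (∫ x in A..B, G x * Real.exp (κ * U x)) ≤ ∫ x in A..B, (G x + κ * (G x * U x) + κ ^ 2 * (G x * U x ^ 2)) := by
    refine intervalIntegral.integral_mono_on hle ?_ ((i0.add i1).add i2) ?_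
    · exact (hGc.mul (Real.continuous_exp.comp (continuous_const.mul hUc))).intervalIntegrable _ _
    · intro x _
      have := mul_le_mul_of_nonneg_left (hexp x) (hG0 x)
      linarith
  rw [intervalIntegral.integral_add (i0.add i1) i2, intervalIntegral.integral_add i0 i1, intervalIntegral.integral_const_mul,
    intervalIntegral.integral_const_mul] at h1
  refine h1.trans ?_
  have h2 := mul_le_mul_of_nonneg_left m1 hκ
  have h3 := mul_le_mul_of_nonneg_left m2 (sq_nonneg κ)
  have h4 : κ * (16 * δ * L * ∫ x in A..B, G x) ≤ κ * (16 * (κ * τ) * L * ∫ x in A..B, G x) := by gcongr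
  set I := ∫ x in A..B, G x
  calc _ ≤ ((16 + 262 / (1 - θ)) * (κ ^ 2 * τ * L) + 1) * I := by
        have : κ ^ 2 * (131 * τ * (2 / (1 - θ)) * L * I) = 262 / (1 - θ) * (κ ^ 2 * τ * L) * I := by ring
        rw [this] at h3
        linarith
    _ ≤ _ := mul_le_mul_of_nonneg_right (Real.add_one_le_exp _) hI

noncomputable def hlog (m a T : ℝ) : ℝ := (1 + Real.exp (m * (T - a)))⁻¹

lemma hlog_pos (m a T : ℝ) : 0 < hlog m a T := by unfold hlog; positivity
lemma hlog_le_one (m a T : ℝ) : hlog m a T ≤ 1 := by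
  unfold hlog; apply inv_le_one_of_one_le₀; linarith [Real.exp_pos (m * (T - a))]

lemma hlog_half {m a T : ℝ} (hm : 0 ≤ m) (h : a ≤ T) : hlog m a T ≤ 1 / 2 := by
  unfold hlog
  rw [one_div]
  apply inv_anti₀ (by norm_num)
  have : 1 ≤ Real.exp (m * (T - a)) := Real.one_le_exp (mul_nonneg hm (by linarith))
  linarith

lemma hlog_pt {m a T : ℝ} (hm : 0 ≤ m) :
    1 - hlog m a T ≤ Real.exp (-m) + Real.exp (1 - a) * (Real.exp T * (1 - hlog m a T)) := by
  have h1 := hlog_le_one m a T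
  rcases le_total (a - 1) T with h | h
  · have : 1 ≤ Real.exp (1 - a) * Real.exp T := by
      rw [← Real.exp_add]; exact Real.one_le_exp (by linarith)
    have h3 := Real.exp_pos (-m)
    rw [← mul_assoc]
    nlinarith
  · have h2 : 1 - hlog m a T ≤ Real.exp (m * (T - a)) := by
      unfold hlog
      have hp := Real.exp_pos (m * (T - a))
      rw [sub_le_iff_le_add, ← sub_le_iff_le_add', ← one_div, le_div_iff₀ (by positivity)]
      nlinarith
    have h3 : Real.exp (m * (T - a)) ≤ Real.exp (-m) := by
      apply Real.exp_le_exp.2; nlinarith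
    have h4 : 0 ≤ Real.exp (1 - a) * (Real.exp T * (1 - hlog m a T)) := by
      have : 0 ≤ 1 - hlog m a T := by linarith
      positivity
    linarith

noncomputable def Hp (m a : ℝ) (T : ℕ → ℝ → ℝ) (i : ℕ) (x : ℝ) : ℝ :=
  ∏ j ∈ Finset.range i, hlog m a (T (j + 1) x)

lemma Hp_succ (m a : ℝ) (T : ℕ → ℝ → ℝ) (i : ℕ) (x : ℝ) :
    Hp m a T (i + 1) x = Hp m a T i x * hlog m a (T (i + 1) x) := Finset.prod_range_succ _ _

lemma Hp_pos (m a : ℝ) (T : ℕ → ℝ → ℝ) (i : ℕ) (x : ℝ) : 0 < Hp m a T i x :=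
  Finset.prod_pos fun _ _ => hlog_pos _ _ _

lemma Hp_le_one (m a : ℝ) (T : ℕ → ℝ → ℝ) (i : ℕ) (x : ℝ) : Hp m a T i x ≤ 1 :=
  Finset.prod_le_one (fun _ _ => (hlog_pos _ _ _).le) fun _ _ => hlog_le_one _ _ _

lemma Hp_half {m a : ℝ} (hm : 0 ≤ m) (T : ℕ → ℝ → ℝ) {K i : ℕ} (hi : 1 ≤ i) (hiK : i ≤ K) {x : ℝ} (h : a ≤ T i x) :
    Hp m a T K x ≤ 1 / 2 := by
  unfold Hp
  have hmem : i - 1 ∈ Finset.range K := by simp; omega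
  rw [← Finset.mul_prod_erase _ _ hmem, show i - 1 + 1 = i by omega]
  have h1 := hlog_half hm h
  have h2 : ∏ j ∈ (Finset.range K).erase (i-1), hlog m a (T (j + 1) x) ≤ 1 :=
    Finset.prod_le_one (fun _ _ => (hlog_pos _ _ _).le) fun _ _ => hlog_le_one _ _ _
  have h3 : 0 < ∏ j ∈ (Finset.range K).erase (i-1), hlog m a (T (j + 1) x) :=
    Finset.prod_pos fun _ _ => hlog_pos _ _ _
  nlinarith [hlog_pos m a (T i x)]

lemma contDiff_hlog {m a : ℝ} {T : ℝ → ℝ} (h : ContDiff ℝ 1 T) : ContDiff ℝ 1 (fun x => hlog m a (T x)) := by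
  unfold hlog
  refine ContDiff.inv (by fun_prop) fun x => ?_
  positivity

lemma contDiff_Hp {m a : ℝ} {T : ℕ → ℝ → ℝ} (h : ∀ i, ContDiff ℝ 1 (T i)) (i : ℕ) : ContDiff ℝ 1 (Hp m a T i) := by
  unfold Hp
  exact contDiff_prod fun j _ => contDiff_hlog (h _)

lemma deriv_hlog {m a : ℝ} (hm : 0 ≤ m) {T : ℝ → ℝ} (h : ContDiff ℝ 1 T) {x Λ : ℝ} (hΛ : |deriv T x| ≤ Λ) :
    |deriv (fun x => hlog m a (T x)) x| ≤ m * Λ * hlog m a (T x) := by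
  have hT := ((h.differentiable (by norm_num)) x).hasDerivAt
  have hp : (0:ℝ) < 1 + Real.exp (m * (T x - a)) := by positivity
  have := ((((hT.sub_const a).const_mul m).exp).const_add 1).inv hp.ne'
  have h2 : deriv (fun x => hlog m a (T x)) x = -(Real.exp (m * (T x - a)) * (m * deriv T x)) / (1 + Real.exp (m * (T x - a))) ^ 2 :=
    this.deriv
  rw [h2, abs_div, abs_neg, abs_mul, abs_mul, abs_of_nonneg hm, abs_of_pos (Real.exp_pos _), abs_of_pos (by positivity : (0:ℝ) < (1 + Real.exp (m * (T x - a))) ^ 2)]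
  unfold hlog
  set E := Real.exp (m * (T x - a))
  have hE : 0 < E := Real.exp_pos _
  rw [div_le_iff₀ (by positivity)]
  rw [show m * Λ * (1 + E)⁻¹ * (1 + E) ^ 2 = (1 + E) * (m * Λ) by field_simp]
  have h0 : 0 ≤ |deriv T x| := abs_nonneg _
  have h3 : m * |deriv T x| ≤ m * Λ := mul_le_mul_of_nonneg_left hΛ hm
  have h4 : 0 ≤ m * |deriv T x| := by positivity
  nlinarith

lemma deriv_Hp {m a : ℝ} (hm : 0 ≤ m) {T : ℕ → ℝ → ℝ} (h : ∀ i, ContDiff ℝ 1 (T i)) (i : ℕ) {x Λ : ℝ}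
    (hΛ : ∀ j ≤ i, |deriv (T j) x| ≤ Λ) :
    |deriv (Hp m a T i) x| ≤ i * m * Λ * Hp m a T i x := by
  induction i with
  | zero => 
    have : Hp m a T 0 = fun _ => 1 := by ext; simp [Hp]
    simp [this]
  | succ i ih =>
    have ih := ih fun j hj => hΛ j (by omega)
    have e : Hp m a T (i+1) = fun x => Hp m a T i x * hlog m a (T (i + 1) x) := by ext x; exact Hp_succ ..
    have d1 := (((contDiff_Hp (m := m) (a := a) h i).differentiable (by norm_num)) x).hasDerivAt
    have d2 := (((contDiff_hlog (m := m) (a := a) (h (i+1))).differentiable (by norm_num)) x).hasDerivAt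
    have d3 : deriv (fun x => Hp m a T i x * hlog m a (T (i + 1) x)) x =
        deriv (Hp m a T i) x * hlog m a (T (i + 1) x) + Hp m a T i x * deriv (fun x => hlog m a (T (i + 1) x)) x :=
      (d1.mul d2).deriv
    rw [Hp_succ, e, d3]
    refine (abs_add_le _ _).trans ?_
    have p1 := Hp_pos m a T i x
    have p2 := hlog_pos m a (T (i+1) x)
    rw [abs_mul, abs_mul, abs_of_pos p1, abs_of_pos p2]
    have h3 := deriv_hlog (a := a) hm (h (i+1)) (hΛ (i+1) le_rfl)
    have h4 := mul_le_mul_of_nonneg_right ih p2.le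
    have h5 := mul_le_mul_of_nonneg_left h3 p1.le
    push_cast
    nlinarith

lemma deriv_G {m a : ℝ} (hm : 0 ≤ m) {T : ℕ → ℝ → ℝ} (h : ∀ i, ContDiff ℝ 1 (T i)) (i : ℕ) {x Λ : ℝ}
    (hΛ : ∀ j ≤ i, |deriv (T j) x| ≤ Λ) :
    |deriv (fun x => Hp m a T i x * Real.exp (T i x)) x| ≤ (i * m + 1) * Λ * (Hp m a T i x * Real.exp (T i x)) := by
  have d1 := (((contDiff_Hp (m := m) (a := a) h i).differentiable (by norm_num)) x).hasDerivAt
  have d2 := (((h i).differentiable (by norm_num)) x).hasDerivAt.exp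
  have d3 : deriv (fun x => Hp m a T i x * Real.exp (T i x)) x = _ := (d1.mul d2).deriv
  rw [d3]
  refine (abs_add_le _ _).trans ?_
  have p1 := Hp_pos m a T i x
  have p2 := Real.exp_pos (T i x)
  rw [abs_mul, abs_mul, abs_mul, abs_of_pos p1, abs_of_pos p2]
  have h4 := mul_le_mul_of_nonneg_right (deriv_Hp (a := a) hm h i hΛ) p2.le
  have h5 := mul_le_mul_of_nonneg_left (hΛ i le_rfl) (mul_pos p1 p2).le
  nlinarith

lemma doob {A B : ℝ} (hAB : B - A = 1) {m a : ℝ} (hm : 0 ≤ m) {T : ℕ → ℝ → ℝ} (h : ∀ i, ContDiff ℝ 1 (T i))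
    (h0 : ∀ x, T 0 x = 0) {K : ℕ}
    (hstep : ∀ i < K, (∫ x in A..B, Hp m a T i x * Real.exp (T (i+1) x)) ≤ ∫ x in A..B, Hp m a T i x * Real.exp (T i x)) :
    (volume {x ∈ Set.Icc A B | ∃ i, 1 ≤ i ∧ i ≤ K ∧ a ≤ T i x}).toReal ≤ 2 * (K * Real.exp (-m) + Real.exp (1 - a)) := by
  have hle : A ≤ B := by linarith
  have cH : ∀ i, Continuous (Hp m a T i) := fun i => (contDiff_Hp h i).continuous
  have cT : ∀ i, Continuous (T i) := fun i => (h i).continuous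
  have cI : ∀ {k : ℝ → ℝ}, Continuous k → IntervalIntegrable k volume A B := fun hk => hk.intervalIntegrable _ _
  have key : ∀ i ≤ K, (∫ x in A..B, (1 - Hp m a T i x)) + Real.exp (1 - a) * (∫ x in A..B, Hp m a T i x * Real.exp (T i x))
      ≤ i * Real.exp (-m) + Real.exp (1 - a) := by
    intro i
    induction i with
    | zero =>
      intro _
      have : Hp m a T 0 = fun _ => 1 := by ext; simp [Hp]
      simp [this, h0, hAB]
    | succ i ih =>
      intro hi
      have ih := ih (by omega)
      have hs := mul_le_mul_of_nonneg_left (hstep i (by omega)) (Real.exp_pos (1 - a)).le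
      have c1 := cH i
      have c2 := cH (i+1)
      have c3 := cT i
      have c4 := cT (i+1)
      have hm1 : (∫ x in A..B, (1 - Hp m a T (i+1) x)) ≤ ∫ x in A..B, ((1 - Hp m a T i x) + (Real.exp (-m) +
          (Real.exp (1 - a) * (Hp m a T i x * Real.exp (T (i+1) x)) - Real.exp (1 - a) * (Hp m a T (i+1) x * Real.exp (T (i+1) x))))) := by
        refine intervalIntegral.integral_mono_on hle (cI (by fun_prop)) (cI (by fun_prop)) ?_
        intro x _
        rw [Hp_succ]
        have q1 := Hp_pos m a T i x
        have q2 := Hp_le_one m a T i x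
        have q3 := mul_le_mul_of_nonneg_left (hlog_pt (a := a) (T := T (i+1) x) hm) q1.le
        have q4 := Real.exp_pos (-m)
        nlinarith
      rw [intervalIntegral.integral_add (cI (by fun_prop)) (cI (by fun_prop)), intervalIntegral.integral_add (cI (by fun_prop)) (cI (by fun_prop)),
        intervalIntegral.integral_sub (f := fun x => Real.exp (1 - a) * (Hp m a T i x * Real.exp (T (i+1) x))) (cI (by fun_prop)) (cI (by fun_prop)), intervalIntegral.integral_const_mul,
        intervalIntegral.integral_const_mul, intervalIntegral.integral_const, hAB, one_smul] at hm1
      push_cast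
      linarith
  have key := key K le_rfl
  have hnn : 0 ≤ ∫ x in A..B, Hp m a T K x * Real.exp (T K x) :=
    intervalIntegral.integral_nonneg hle fun x _ => (mul_pos (Hp_pos ..) (Real.exp_pos _)).le
  have key2 : (∫ x in A..B, (1 - Hp m a T K x)) ≤ K * Real.exp (-m) + Real.exp (1 - a) := by
    nlinarith [Real.exp_pos (1 - a)]
  set S := {x ∈ Set.Icc A B | ∃ i, 1 ≤ i ∧ i ≤ K ∧ a ≤ T i x} with hS
  have cK := cH K
  have hmark := mul_meas_ge_le_integral_of_nonneg (μ := volume.restrict (Set.Ioc A B)) (f := fun x => 1 - Hp m a T K x)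
    (Eventually.of_forall fun x => by simpa using Hp_le_one m a T K x)
    ((by fun_prop : Continuous fun x => 1 - Hp m a T K x).integrableOn_Ioc) (1/2)
  rw [← intervalIntegral.integral_of_le hle] at hmark
  have hsub : volume S ≤ (volume.restrict (Set.Ioc A B)) {x | 1/2 ≤ 1 - Hp m a T K x} := by
    rw [← Measure.restrict_congr_set (Ioc_ae_eq_Icc (μ := volume)).symm]
    rw [Measure.restrict_apply (measurableSet_le (by fun_prop) (by fun_prop))]
    apply measure_mono
    rintro x ⟨hx, i, hi1, hi2, hi3⟩
    refine ⟨?_, hx⟩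
    have := Hp_half hm T hi1 hi2 hi3
    simp only [Set.mem_ofPred_eq]; linarith
  have h3 : (volume S).toReal ≤ ((volume.restrict (Set.Ioc A B)) {x | 1/2 ≤ 1 - Hp m a T K x}).toReal :=
    ENNReal.toReal_mono (measure_ne_top _ _) hsub
  unfold Measure.real at hmark
  linarith

noncomputable def Tc (ξ κ v : ℝ) (g : ℝ → ℝ) (s : ℕ → ℕ) (o L : ℕ) (i : ℕ) (x : ℝ) : ℝ :=
  κ * (∑ j ∈ Finset.range i, ∑ r ∈ Finset.range L, g (lam ξ (s (o + 2 * j * L + r)) x)) - i * v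

lemma dlam_mono {ξ : ℝ} (hξ : 0 < ξ) {s p : ℕ} (h : s ≤ p) {x : ℝ} (hx : 1 < x) : dlam ξ s x ≤ dlam ξ p x := by
  unfold dlam
  have : (s:ℝ) ≤ p := by exact_mod_cast h
  have h2 : x ^ (s-1) ≤ x ^ (p-1) := pow_le_pow_right₀ hx.le (by omega)
  gcongr

lemma strictMono_add {s : ℕ → ℕ} (hs : StrictMono s) (n d : ℕ) : s n + d ≤ s (n + d) := by
  induction d with
  | zero => simp
  | succ d ih =>
    have := hs (show n + d < n + (d + 1) by omega)
    omega

lemma chain {A B ξ : ℝ} (hA : 1 < A) (hAB : B - A = 1) (hξ : 0 < ξ) 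
    {g : ℝ → ℝ} (hg : Sm g) {τ : ℝ} (hτ0 : 0 ≤ τ)
    (hS : ∫ x in (0:ℝ)..1, (g x) ^ 2 ≤ τ ^ 2) {s : ℕ → ℕ} (hs : StrictMono s)
    {Mg : ℝ} (hMg : ∀ x, |deriv g x| ≤ Mg)
    {δ : ℝ} (hδ : 0 ≤ δ) (hδ1 : δ ≤ 1) {L K o : ℕ} (ho : L + 1 ≤ o) (hL : 1 ≤ L)
    {θ : ℝ} (hθ0 : 0 ≤ θ) (hθ1 : θ < 1) (hθ : θ ^ 2 = A⁻¹) {κ : ℝ} (hκ : 0 ≤ κ) (hκL : κ * (2 * L) ≤ 1)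
    (hδκ : δ ≤ κ * τ) {m a : ℝ} (hm : 0 ≤ m)
    (hδa : ξ⁻¹ ≤ δ * A ^ L) (hδb : (K * m + 1) * (κ * (K * L * Mg)) ≤ δ * A ^ L) :
    (volume {x ∈ Set.Icc A B | ∃ i, 1 ≤ i ∧ i ≤ K ∧ 
      a ≤ Tc ξ κ ((16 + 262 / (1 - θ)) * (κ ^ 2 * τ * L)) g s o L i x}).toReal ≤ 2 * (K * Real.exp (-m) + Real.exp (1 - a)) := by
  have hA0 : 0 < A := by linarith
  have hle : A ≤ B := by linarith
  set v := (16 + 262 / (1 - θ)) * (κ ^ 2 * τ * L) with hv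
  have hMg0 : 0 ≤ Mg := (abs_nonneg _).trans (hMg 0)
  have hlamC : ∀ n, ContDiff ℝ 1 (lam ξ n) := fun n => by unfold lam; fun_prop
  have hTC : ∀ i, ContDiff ℝ 1 (Tc ξ κ v g s o L i) := by
    intro i
    unfold Tc
    refine ContDiff.sub (contDiff_const.mul (ContDiff.sum fun j _ => ContDiff.sum fun r _ => hg.cd.comp (hlamC _))) contDiff_const
  have hidx : ∀ n, n ≤ s n := fun n => hs.le_apply
  refine doob hAB hm hTC (by intro x; simp [Tc]) ?_
  intro i hi
  set G : ℝ → ℝ := fun x => Hp m a (Tc ξ κ v g s o L) i x * Real.exp (Tc ξ κ v g s o L i x) with hGdef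
  have hG0 : ∀ x, 0 ≤ G x := fun x => (mul_pos (Hp_pos ..) (Real.exp_pos _)).le
  have hGC : ContDiff ℝ 1 G := (contDiff_Hp hTC i).mul (Real.contDiff_exp.comp (hTC i))
  set p : ℕ := if i = 0 then 0 else s (o + 2 * (i - 1) * L + (L - 1)) with hp
  -- derivative bound
  have hder : ∀ x ∈ Set.Icc A B, ∀ j ≤ i, |deriv (Tc ξ κ v g s o L j) x| ≤ κ * (K * L * Mg) * dlam ξ p x := by
    intro x hx j hj
    have hx1 : 1 < x := by linarith [hx.1]
    have hd : HasDerivAt (Tc ξ κ v g s o L j) (κ * (∑ j ∈ Finset.range j, ∑ r ∈ Finset.range L,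
       deriv g (lam ξ (s (o + 2 * j * L + r)) x) * dlam ξ (s (o + 2 * j * L + r)) x)) x := by
      unfold Tc
      refine HasDerivAt.sub_const _ (HasDerivAt.const_mul κ (HasDerivAt.fun_sum fun j _ => HasDerivAt.fun_sum fun r _ => ?_))
      exact HasDerivAt.comp x ((hg.cd.differentiable (by norm_num)) _).hasDerivAt (hasDerivAt_lam ξ _ x)
    rw [hd.deriv, abs_mul, abs_of_nonneg hκ, mul_assoc]
    apply mul_le_mul_of_nonneg_left _ hκ
    have hdp : 0 ≤ dlam ξ p x := by unfold dlam; positivity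
    calc _ ≤ ∑ j ∈ Finset.range j, ∑ r ∈ Finset.range L, Mg * dlam ξ p x := by
          refine (Finset.abs_sum_le_sum_abs _ _).trans (Finset.sum_le_sum fun k hk => ?_)
          refine (Finset.abs_sum_le_sum_abs _ _).trans (Finset.sum_le_sum fun r hr => ?_)
          rw [Finset.mem_range] at hk hr
          have hdn : 0 ≤ dlam ξ (s (o + 2 * k * L + r)) x := by unfold dlam; positivity
          rw [abs_mul, abs_of_nonneg hdn]
          refine mul_le_mul (hMg _) (dlam_mono hξ ?_ hx1) hdn hMg0
          rw [hp, if_neg (by omega)]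
          apply hs.monotone
          have h1 : k * L ≤ (i - 1) * L := Nat.mul_le_mul_right _ (by omega)
          have e1 : 2 * k * L = 2 * (k * L) := by ring
          have e2 : 2 * (i - 1) * L = 2 * ((i - 1) * L) := by ring
          omega
      _ = j * L * Mg * dlam ξ p x := by simp; ring
      _ ≤ _ := by
          have : (j:ℝ) ≤ K := by exact_mod_cast (by omega : j ≤ K)
          gcongr
  set e : ℕ → ℕ := fun r => s (o + 2 * i * L + r) with he
  have hem : StrictMono e := fun x y hxy => hs (by omega)
  have he1 : ∀ r, 1 ≤ e r := fun r => le_trans (by omega) (hidx _)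
  have hgap : ∀ r, p + (L + r) ≤ e r := by
    intro r
    by_cases h : i = 0
    · simp only [hp, if_pos h, he]
      have := hidx (o + 2 * i * L + r)
      omega
    · simp only [hp, if_neg h, he]
      obtain ⟨k, rfl⟩ : ∃ k, i = k + 1 := ⟨i - 1, by omega⟩
      have h2 := strictMono_add hs (o + 2 * k * L + (L-1)) (L + 1 + r)
      have : o + 2 * (k+1) * L + r = o + 2 * k * L + (L-1) + (L + 1 + r) := by
        have : 2 * (k+1) * L = 2 * k * L + 2 * L := by ring
        omega
      rw [this]
      simp only [Nat.add_sub_cancel]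
      omega
  have hW : ∀ r < L, Wt A B ξ G (e r) (δ * (A ^ r)⁻¹) := by
    intro r _
    have hbase : (ξ * A ^ (e r - 1))⁻¹ ≤ δ * (A ^ r)⁻¹ := by
      have h1 : L + r ≤ e r - 1 := by
        have := hidx (o + 2 * i * L + r)
        simp only [he]; omega
      have h2 : A ^ L * A ^ r ≤ A ^ (e r - 1) := by
        rw [← pow_add]; exact pow_le_pow_right₀ hA.le h1
      have hAL : 0 < A ^ L := by positivity
      have hAr : 0 < A ^ r := by positivity
      calc (ξ * A ^ (e r - 1))⁻¹ ≤ (ξ * (A ^ L * A ^ r))⁻¹ := inv_anti₀ (by positivity) (by gcongr)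
        _ = ξ⁻¹ * (A ^ L)⁻¹ * (A ^ r)⁻¹ := by field_simp
        _ ≤ (δ * A ^ L) * (A ^ L)⁻¹ * (A ^ r)⁻¹ := by gcongr
        _ = _ := by field_simp
    refine ⟨fun x hx => (phi_le hξ (he1 r) hA hx.1).trans hbase, fun x hx => (dphi_le hξ (he1 r) hA hx.1).trans hbase, ?_⟩
    intro x hx
    have hx0 : 0 < x := by linarith [hx.1]
    have h1 := deriv_G (a := a) hm hTC i (hder x hx)
    have hph := phi_pos hξ (he1 r) hx0
    have h2 := dlam_phi_le hA hξ (hgap r) (he1 r) hx.1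
    have hAL : 0 < A ^ L := by positivity
    have hAr : 0 < A ^ r := by positivity
    have hKi : (i:ℝ) ≤ K := by exact_mod_cast hi.le
    have hGx := hG0 x
    have hdph : 0 ≤ dlam ξ p x * phi ξ (e r) x := mul_nonneg (by unfold dlam; positivity) hph.le
    calc |deriv G x| * phi ξ (e r) x ≤ ((i * m + 1) * (κ * (K * L * Mg) * dlam ξ p x) * G x) * phi ξ (e r) x :=
          mul_le_mul_of_nonneg_right h1 hph.le
      _ = ((i * m + 1) * (κ * (K * L * Mg))) * (dlam ξ p x * phi ξ (e r) x) * G x := by ring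
      _ ≤ ((K * m + 1) * (κ * (K * L * Mg))) * (A ^ (L + r))⁻¹ * G x := by
          gcongr
      _ ≤ (δ * A ^ L) * (A ^ (L + r))⁻¹ * G x := by gcongr
      _ = _ := by rw [pow_add]; field_simp
  have hb := block hA hAB hξ hGC hG0 hg hτ0  hS hem he1 hδ hδ1 hW hθ0 hθ1 hθ hκ hκL hδκ
  have hid : ∀ x, Hp m a (Tc ξ κ v g s o L) i x * Real.exp (Tc ξ κ v g s o L (i+1) x) =
      Real.exp (-v) * (G x * Real.exp (κ * ∑ r ∈ Finset.range L, g (lam ξ (e r) x))) := by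
    intro x
    have ht : Tc ξ κ v g s o L (i+1) x = -v + (Tc ξ κ v g s o L i x + κ * ∑ r ∈ Finset.range L, g (lam ξ (e r) x)) := by
      simp only [Tc, Finset.sum_range_succ, he]
      push_cast
      ring
    rw [ht, Real.exp_add, Real.exp_add]
    simp only [hGdef]
    ring
  simp only [hid]
  rw [intervalIntegral.integral_const_mul]
  calc _ ≤ Real.exp (-v) * (Real.exp v * ∫ x in A..B, G x) := mul_le_mul_of_nonneg_left hb (Real.exp_pos _).le
    _ = _ := by rw [← mul_assoc, ← Real.exp_add]; simp

lemma exists_V {f : ℝ → ℝ} (hf : ∀ x, f (x + 1) = f x) (hv : eVariationOn f (Set.Icc (0:ℝ) 1) ≤ 2) :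
    ∃ (V : ℝ → ℝ) (v : ℝ), v ≤ 2 ∧ (∀ x, V (x + 1) = V x + v) ∧ ∀ x y, x ≤ y → |f y - f x| ≤ V y - V x := by
  set U : ℝ → ℝ := fun t => (eVariationOn f (Set.Icc 0 t)).toReal with hU
  have hfin : ∀ t ≤ 1, eVariationOn f (Set.Icc 0 t) ≠ ⊤ := fun t ht =>
    ((eVariationOn.mono f (Set.Icc_subset_Icc_right ht)).trans_lt (hv.trans_lt (by norm_num))).ne
  have key : ∀ a b, 0 ≤ a → a ≤ b → b ≤ 1 → |f b - f a| ≤ U b - U a := by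
    intro a b ha hab hb
    have h1 := eVariationOn.Icc_add_Icc f (s := Set.univ) ha hab (Set.mem_univ _)
    simp only [Set.univ_inter] at h1
    have h2 : eVariationOn f (Set.Icc a b) ≠ ⊤ := by
      intro h
      rw [h] at h1
      exact hfin b hb (by rw [← h1]; simp)
    have h3 := eVariationOn.edist_le f (s := Set.Icc a b) (x := b) (y := a) ⟨hab, le_rfl⟩ ⟨le_rfl, hab⟩
    have h4 : dist (f b) (f a) ≤ (eVariationOn f (Set.Icc a b)).toReal := by
      rw [dist_edist]; exact ENNReal.toReal_mono h2 h3
    have h5 : U b = U a + (eVariationOn f (Set.Icc a b)).toReal := by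
      simp only [hU]
      rw [← h1, ENNReal.toReal_add (hfin a (hab.trans hb)) h2]
    rw [Real.dist_eq] at h4
    linarith
  have hU0 : U 0 = 0 := by simp [hU, eVariationOn.subsingleton]
  have hper : Function.Periodic f 1 := hf
  have hfr : ∀ x, f (Int.fract x) = f x := by
    intro x
    have := hper.sub_int_mul_eq (x := x) ⌊x⌋
    rw [mul_one] at this
    rw [← this]; rfl
  have hf1 : f 1 = f 0 := by have := hf 0; rwa [zero_add] at this
  refine ⟨fun x => U 1 * ⌊x⌋ + U (Int.fract x), U 1, ?_, ?_, ?_⟩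
  · simp only [hU]
    exact ENNReal.toReal_le_of_le_ofReal (by norm_num) (by simpa using hv)
  · intro x
    simp
    ring
  · intro x y hxy
    have hx0 := Int.fract_nonneg x
    have hx1 := (Int.fract_lt_one x).le
    have hy0 := Int.fract_nonneg y
    have hy1 := (Int.fract_lt_one y).le
    rw [← hfr x, ← hfr y]
    rcases (Int.floor_mono hxy).lt_or_eq with h | h
    · have h1 : (⌊x⌋ : ℝ) + 1 ≤ ⌊y⌋ := by exact_mod_cast h
      have k1 := key _ _ hx0 hx1 le_rfl
      have k2 := key _ _ le_rfl hy0 hy1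
      have k3 := key 0 1 le_rfl zero_le_one le_rfl
      have k4 : 0 ≤ U 1 := by have := abs_nonneg (f 1 - f 0); linarith
      rw [hf1] at k1
      have k5 := abs_add_le (f (Int.fract y) - f 0) (f 0 - f (Int.fract x))
      rw [sub_add_sub_cancel] at k5
      simp only
      nlinarith
    · have hxy' : Int.fract x ≤ Int.fract y := by
        unfold Int.fract; rw [h]; linarith
      have k1 := key _ _ hx0 hxy' hy1
      simp only [h]
      linarith

lemma quasi {W : ℝ → ℝ} {v : ℝ} (hi : ∀ a b, IntervalIntegrable W volume a b) (hW : ∀ x, W (x + 1) = W x + v) (c d : ℝ) :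
    ∫ x in (0:ℝ)..1, (W (x + c) - W (x + d)) = (c - d) * v := by
  have hi2 : ∀ c a b, IntervalIntegrable (fun x => W (x + c)) volume a b := by
    intro c a b
    have := (hi (a + c) (b + c)).comp_add_right c
    simpa using this
  have key : ∀ c, ∫ x in (0:ℝ)..1, W (x + c) = (∫ x in (0:ℝ)..1, W x) + c * v := by
    intro c
    rw [intervalIntegral.integral_comp_add_right]
    have h1 : ∫ x in (0:ℝ)..c, W (x + 1) = (∫ x in (0:ℝ)..c, W x) + c * v := by
      simp only [hW]
      rw [intervalIntegral.integral_add (hi _ _) (by simp)]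
      simp
    rw [intervalIntegral.integral_comp_add_right] at h1
    have h2 := intervalIntegral.integral_add_adjacent_intervals (hi 0 1) (hi 1 (1 + c))
    have h3 := intervalIntegral.integral_add_adjacent_intervals (hi 0 c) (hi c (1 + c))
    rw [zero_add, add_comm c 1] at h1
    rw [zero_add]
    linarith
  rw [intervalIntegral.integral_sub (hi2 _ _ _) (hi2 _ _ _), key, key]
  ring

noncomputable def avg (h : ℝ) (F : ℝ → ℝ) (x : ℝ) : ℝ := h⁻¹ * ∫ t in x..(x + h), F t

section
variable {h : ℝ} {F : ℝ → ℝ}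

lemma avg_eq (h : ℝ) (F : ℝ → ℝ) (x : ℝ) : avg h F x = h⁻¹ * ∫ t in (0:ℝ)..h, F (x + t) := by
  unfold avg
  rw [intervalIntegral.integral_comp_add_left, add_zero]

lemma avg_eq2 (hi : ∀ a b, IntervalIntegrable F volume a b) (x : ℝ) :
    avg h F x = h⁻¹ * ((∫ t in (0:ℝ)..(x + h), F t) - ∫ t in (0:ℝ)..x, F t) := by
  unfold avg
  rw [intervalIntegral.integral_interval_sub_left (hi _ _) (hi _ _)]

lemma avg_cont (hi : ∀ a b, IntervalIntegrable F volume a b) : Continuous (avg h F) := by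
  have : avg h F = fun x => h⁻¹ * ((∫ t in (0:ℝ)..(x + h), F t) - ∫ t in (0:ℝ)..x, F t) := funext (avg_eq2 hi)
  rw [this]
  have hc := intervalIntegral.continuous_primitive hi 0
  have hc2 : Continuous fun x => ∫ t in (0:ℝ)..(x + h), F t := hc.comp (continuous_id.add continuous_const)
  exact continuous_const.mul (hc2.sub hc)

lemma avg_deriv (hc : Continuous F) (x : ℝ) : HasDerivAt (avg h F) (h⁻¹ * (F (x + h) - F x)) x := by
  have hi : ∀ a b, IntervalIntegrable F volume a b := fun a b => hc.intervalIntegrable a b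
  have : avg h F = fun x => h⁻¹ * ((∫ t in (0:ℝ)..(x + h), F t) - ∫ t in (0:ℝ)..x, F t) := funext (avg_eq2 hi)
  rw [this]
  have hd : ∀ y, HasDerivAt (fun y => ∫ t in (0:ℝ)..y, F t) (F y) y := fun y =>
    intervalIntegral.integral_hasDerivAt_right (hi _ _) (hc.stronglyMeasurableAtFilter _ _) hc.continuousAt
  exact ((hd (x + h)).comp_add_const x h |>.sub (hd x)).const_mul _

lemma avg_le (hh : 0 < h) (hi : ∀ a b, IntervalIntegrable F volume a b) {x c : ℝ} (hb : ∀ t ∈ Set.Icc x (x + h), F t ≤ c) :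
    avg h F x ≤ c := by
  have h1 : ∫ t in x..(x + h), F t ≤ ∫ t in x..(x+h), c :=
    intervalIntegral.integral_mono_on (by linarith) (hi _ _) (by simp) hb
  simp only [intervalIntegral.integral_const, add_sub_cancel_left, smul_eq_mul] at h1
  unfold avg
  calc _ ≤ h⁻¹ * (h * c) := by gcongr
    _ = c := by field_simp

lemma le_avg (hh : 0 < h) (hi : ∀ a b, IntervalIntegrable F volume a b) {x c : ℝ} (hb : ∀ t ∈ Set.Icc x (x + h), c ≤ F t) :
    c ≤ avg h F x := by
  have h1 : ∫ t in x..(x+h), c ≤ ∫ t in x..(x + h), F t :=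
    intervalIntegral.integral_mono_on (by linarith) (by simp) (hi _ _) hb
  simp only [intervalIntegral.integral_const, add_sub_cancel_left, smul_eq_mul] at h1
  unfold avg
  calc c = h⁻¹ * (h * c) := by field_simp
    _ ≤ _ := by gcongr

lemma avg_quasi (hh : 0 < h) (hi : ∀ a b, IntervalIntegrable F volume a b) {v : ℝ} (hF : ∀ x, F (x + 1) = F x + v) (x : ℝ) :
    avg h F (x + 1) = avg h F x + v := by
  have hi2 : ∀ x a b, IntervalIntegrable (fun t => F (x + t)) volume a b := by
    intro c a b
    have := (hi (a + c) (b + c)).comp_add_left c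
    simpa using this
  rw [avg_eq, avg_eq]
  have : ∀ t, F (x + 1 + t) = F (x + t) + v := fun t => by rw [← hF]; ring_nf
  simp only [this]
  rw [intervalIntegral.integral_add (hi2 _ _ _) (by simp)]
  simp
  field_simp

lemma avg_mean (hi : ∀ a b, IntervalIntegrable F volume a b) (hF : ∀ x, F (x + 1) = F x)
    (h0 : ∫ x in (0:ℝ)..1, F x = 0) : ∫ x in (0:ℝ)..1, avg h F x = 0 := by
  simp only [avg_eq2 hi]
  rw [intervalIntegral.integral_const_mul]
  have hc := intervalIntegral.continuous_primitive hi 0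
  have := quasi (W := fun x => ∫ t in (0:ℝ)..x, F t) (v := 0) (fun a b => hc.intervalIntegrable a b) (by
    intro x
    have hp : Function.Periodic F 1 := hF
    have e := hp.intervalIntegral_add_eq x 0
    simp only [zero_add, h0] at e
    rw [← intervalIntegral.integral_add_adjacent_intervals (hi 0 x) (hi x (x+1)), e]) h 0
  simp only [add_zero, mul_zero] at this
  rw [this, mul_zero]

lemma avg_diff (hh : 0 < h) (hi : ∀ a b, IntervalIntegrable F volume a b) {V : ℝ → ℝ}
   (hiV : ∀ a b, IntervalIntegrable V volume a b) (hV : ∀ x y, x ≤ y → |F y - F x| ≤ V y - V x) :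
    ∀ x y, x ≤ y → |avg h F y - avg h F x| ≤ avg h V y - avg h V x := by
  have hi2 : ∀ {F : ℝ → ℝ}, (∀ a b, IntervalIntegrable F volume a b) →  ∀ x a b, IntervalIntegrable (fun t => F (x + t)) volume a b := by
    intro F hi c a b
    have := (hi (a + c) (b + c)).comp_add_left c
    simpa using this
  intro x y hxy
  simp only [avg_eq]
  rw [← mul_sub, ← mul_sub, abs_mul, abs_of_pos (inv_pos.2 hh), ← intervalIntegral.integral_sub (hi2 hi _ _ _) (hi2 hi _ _ _),
    ← intervalIntegral.integral_sub (hi2 hiV _ _ _) (hi2 hiV _ _ _)]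
  apply mul_le_mul_of_nonneg_left _ (inv_pos.2 hh).le
  refine (intervalIntegral.abs_integral_le_integral_abs hh.le).trans ?_
  refine intervalIntegral.integral_mono_on hh.le ((hi2 hi _ _ _).sub (hi2 hi _ _ _)).abs ((hi2 hiV _ _ _).sub (hi2 hiV _ _ _)) ?_
  intro t _
  exact hV _ _ (by linarith)
end

lemma f_props {f : ℝ → ℝ} (h0 : ∫ x in (0:ℝ)..1, f x = 0) (hf : ∀ x, f (x + 1) = f x) {V : ℝ → ℝ} {v : ℝ} (hv : v ≤ 2)
    (hV1 : ∀ x, V (x + 1) = V x + v) (hV : ∀ x y, x ≤ y → |f y - f x| ≤ V y - V x) :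
    Monotone V ∧ (∀ a b, IntervalIntegrable f volume a b) ∧ (∀ x, |f x| ≤ 2) ∧ 
    (∀ a b, IntervalIntegrable (fun x => f x ^ 2) volume a b) := by
  have hm : Monotone V := fun x y hxy => by
    have := abs_nonneg (f y - f x); linarith [hV x y hxy]
  have hm2 : Monotone (fun x => V x - f x) := fun x y hxy => by
    have := le_abs_self (f y - f x); simp only; linarith [hV x y hxy]
  have hfe : f = fun x => V x - (V x - f x) := by ext; ring
  have hi : ∀ a b, IntervalIntegrable f volume a b := by
    intro a b
    rw [hfe]
    exact (hm.monotoneOn _).intervalIntegrable.sub (hm2.monotoneOn _).intervalIntegrable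
  have hmeas : Measurable f := by
    rw [hfe]; exact hm.measurable.sub hm2.measurable
  have hb : ∀ x, |f x| ≤ 2 := by
    intro x
    have hp : Function.Periodic f 1 := hf
    have e := hp.intervalIntegral_add_eq x 0
    simp only [zero_add, h0] at e
    have e1 : f x = ∫ t in x..(x+1), (f x - f t) := by
      rw [intervalIntegral.integral_sub (by simp) (hi _ _), e]; simp
    rw [e1]
    have := intervalIntegral.norm_integral_le_of_norm_le_const (a := x) (b := x + 1) (f := fun t => f x - f t) (C := 2) (by
      intro t ht
      rw [Set.uIoc_of_le (by linarith)] at ht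
      rw [Real.norm_eq_abs, abs_sub_comm]
      have := hV x t ht.1.le
      have := hm ht.2
      rw [hV1] at this
      linarith)
    simpa using this
  refine ⟨hm, hi, hb, ?_⟩
  intro a b
  rw [intervalIntegrable_iff]
  refine Measure.integrableOn_of_bounded (M := 4) (by simp) (hmeas.pow_const 2).aestronglyMeasurable ?_
  refine Eventually.of_forall fun x => ?_
  have := abs_le.1 (hb x)
  rw [Real.norm_eq_abs, abs_of_nonneg (sq_nonneg _)]
  nlinarith

lemma smoothing {f : ℝ → ℝ} (hf : ∀ x, f (x + 1) = f x) (h0 : ∫ x in (0:ℝ)..1, f x = 0)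
    (hv : eVariationOn f (Set.Icc (0:ℝ) 1) ≤ 2) :
    (∀ x, |f x| ≤ 2) ∧ (∀ a b, IntervalIntegrable (fun x => f x ^ 2) volume a b) ∧ ∀ h : ℝ, 0 < h →
    ∃ g q : ℝ → ℝ, Sm g ∧ (∀ x, |deriv g x| ≤ 4 / h) ∧ ∫ x in (0:ℝ)..1, g x ^ 2 ≤ (∫ x in (0:ℝ)..1, f x ^ 2) + 24 * h ∧
      Continuous q ∧ (∀ x, q (x + 1) = q x) ∧ (∀ x, |f x - g x| ≤ q x) ∧ ∫ x in (0:ℝ)..1, q x ≤ 6 * h := by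
  obtain ⟨V, v, hv2, hV1, hV⟩ := exists_V hf hv
  obtain ⟨hm, hi, hb, hi2⟩ := f_props h0 hf hv2 hV1 hV
  refine ⟨hb, hi2, fun h hh => ?_⟩
  have hiV : ∀ a b, IntervalIntegrable V volume a b := fun a b => (hm.monotoneOn _).intervalIntegrable
  have hc1 : Continuous (avg h f) := avg_cont hi
  have hcV : Continuous (avg h V) := avg_cont hiV
  have hi1 : ∀ a b, IntervalIntegrable (avg h f) volume a b := fun a b => hc1.intervalIntegrable a b
  have hiV1 : ∀ a b, IntervalIntegrable (avg h V) volume a b := fun a b => hcV.intervalIntegrable a b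
  have hper1 : ∀ x, avg h f (x + 1) = avg h f x := fun x => by
    have := avg_quasi (v := 0) hh hi (by simpa using hf) x
    simpa using this
  have hb1 : ∀ x, |avg h f x| ≤ 2 := fun x => abs_le.2 
    ⟨le_avg hh hi fun t _ => (abs_le.1 (hb t)).1, avg_le hh hi fun t _ => (abs_le.1 (hb t)).2⟩
  set g := avg h (avg h f) with hg
  have hd : ∀ x, HasDerivAt g (h⁻¹ * (avg h f (x + h) - avg h f x)) x := fun x => avg_deriv hc1 x
  have hdd : deriv g = fun x => h⁻¹ * (avg h f (x + h) - avg h f x) := funext fun x => (hd x).deriv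
  have hcg : Continuous g := avg_cont hi1
  have hbg : ∀ x, |g x| ≤ 2 := fun x => abs_le.2 
    ⟨le_avg hh hi1 fun t _ => (abs_le.1 (hb1 t)).1, avg_le hh hi1 fun t _ => (abs_le.1 (hb1 t)).2⟩
  have hcd : Continuous (deriv g) := by rw [hdd]; fun_prop
  set q : ℝ → ℝ := fun x => avg h V (x + 2 * h) - avg h V (x + -h) with hq
  have hVbar : ∀ x, V x ≤ avg h V x := fun x => le_avg hh hiV fun t ht => hm ht.1
  have hVbar2 : ∀ x, avg h V (x + -h) ≤ V x := fun x => avg_le hh hiV fun t ht => hm (by linarith [ht.2])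
  have hcq : Continuous q := by fun_prop
  have hfq : ∀ x, |f x - g x| ≤ q x := by
    intro x
    have hft : ∀ t ∈ Set.Icc x (x + 2 * h), |f t - f x| ≤ V (x + 2 * h) - V x := fun t ht =>
      (hV x t ht.1).trans (by linarith [hm ht.2])
    have hft2 : ∀ t ∈ Set.Icc x (x + h), |avg h f t - f x| ≤ V (x + 2 * h) - V x := fun t ht => by
      have h1 : avg h f t ≤ f x + (V (x + 2 * h) - V x) := avg_le hh hi fun u hu => by
        have := (abs_le.1 (hft u ⟨by linarith [ht.1, hu.1], by linarith [ht.2, hu.2]⟩)).2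
        linarith
      have h2 : f x - (V (x + 2 * h) - V x) ≤ avg h f t := le_avg hh hi fun u hu => by
        have := (abs_le.1 (hft u ⟨by linarith [ht.1, hu.1], by linarith [ht.2, hu.2]⟩)).1
        linarith
      rw [abs_le]; constructor <;> linarith
    have h1 : g x ≤ f x + (V (x + 2 * h) - V x) := avg_le hh hi1 fun u hu => by
      have := (abs_le.1 (hft2 u hu)).2
      linarith
    have h2 : f x - (V (x + 2 * h) - V x) ≤ g x := le_avg hh hi1 fun u hu => by
      have := (abs_le.1 (hft2 u hu)).1
      linarith
    have h3 := hVbar (x + 2 * h)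
    have h4 := hVbar2 x
    simp only [hq]
    rw [abs_le]; constructor <;> linarith
  have hIq : ∫ x in (0:ℝ)..1, q x ≤ 6 * h := by
    have := quasi hiV1 (avg_quasi hh hiV hV1) (2 * h) (-h)
    simp only [hq]
    rw [this]
    nlinarith
  refine ⟨g, q, ⟨?_, ?_, hbg, avg_mean hi1 hper1 (avg_mean hi hf h0), ?_⟩, ?_, ?_, hcq, ?_, hfq, hIq⟩
  · exact contDiff_one_iff_deriv.2 ⟨fun x => (hd x).differentiableAt, hcd⟩
  · intro x
    have := avg_quasi (v := 0) hh hi1 (by simpa using hper1) x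
    simpa using this
  · calc ∫ x in (0:ℝ)..1, |deriv g x| ≤ ∫ x in (0:ℝ)..1, h⁻¹ * (avg h V (x + h) - avg h V (x + 0)) := by
          refine intervalIntegral.integral_mono_on zero_le_one (hcd.abs.intervalIntegrable _ _) ?_ ?_
          · exact Continuous.intervalIntegrable (by fun_prop) _ _
          · intro x _
            rw [hdd, abs_mul, abs_of_pos (inv_pos.2 hh), add_zero]
            exact mul_le_mul_of_nonneg_left (avg_diff hh hi hiV hV _ _ (by linarith)) (inv_pos.2 hh).le
      _ = v := by
          rw [intervalIntegral.integral_const_mul, quasi hiV1 (avg_quasi hh hiV hV1)]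
          field_simp
          ring
      _ ≤ 4 := by linarith
  · intro x
    rw [hdd, abs_mul, abs_of_pos (inv_pos.2 hh), div_eq_inv_mul]
    apply mul_le_mul_of_nonneg_left _ (inv_pos.2 hh).le
    have := abs_sub (avg h f (x+h)) (avg h f x)
    linarith [hb1 x, hb1 (x+h)]
  · calc ∫ x in (0:ℝ)..1, g x ^ 2 ≤ ∫ x in (0:ℝ)..1, (f x ^ 2 + 4 * q x) := by
          refine intervalIntegral.integral_mono_on zero_le_one ?_ ((hi2 _ _).add ?_) ?_
          · exact Continuous.intervalIntegrable (by fun_prop) _ _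
          · exact Continuous.intervalIntegrable (by fun_prop) _ _
          · intro x _
            have h1 := abs_le.1 (hfq x)
            have h2 := abs_le.1 (hb x)
            have h3 := abs_le.1 (hbg x)
            nlinarith [mul_nonneg (sub_nonneg.2 h1.1) (by linarith : 0 ≤ f x + g x + 4),
              mul_nonneg (sub_nonneg.2 h1.2) (by linarith : 0 ≤ 4 - (f x + g x))]
      _ = (∫ x in (0:ℝ)..1, f x ^ 2) + 4 * ∫ x in (0:ℝ)..1, q x := by
          rw [intervalIntegral.integral_add (hi2 _ _) (Continuous.intervalIntegrable (by fun_prop) _ _), intervalIntegral.integral_const_mul]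
      _ ≤ _ := by linarith
  · intro x
    simp only [hq]
    have e1 := avg_quasi hh hiV hV1 (x + 2 * h)
    have e2 := avg_quasi hh hiV hV1 (x + -h)
    rw [show x + 1 + 2 * h = x + 2 * h + 1 by ring, show x + 1 + -h = x + -h + 1 by ring, e1, e2]
    ring

lemma int_q {A B ξ : ℝ} (hA : 1 < A) (hAB : B - A = 1) (hξ : 0 < ξ) {s : ℕ} (hs : 1 ≤ s) {q : ℝ → ℝ} {Q : ℝ}
    (hc : Continuous q) (hp : ∀ x, q (x + 1) = q x) (hq : ∀ x, 0 ≤ q x)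
    (hQ : ∫ x in (0:ℝ)..1, q x ≤ Q) : ∫ x in A..B, q (lam ξ s x) ≤ Q * (16 * ξ⁻¹ + 1) := by
  have hb : (ξ * A ^ (s - 1))⁻¹ ≤ ξ⁻¹ :=
    inv_anti₀ hξ (le_mul_of_one_le_right hξ.le (one_le_pow₀ hA.le))
  have w : Wt A B ξ (fun _ => 1) s ξ⁻¹ := by
    refine ⟨fun x hx => (phi_le hξ hs hA hx.1).trans hb, fun x hx => (dphi_le hξ hs hA hx.1).trans hb, fun x hx => ?_⟩
    simp [hξ.le]
  have h := w.osc2 hA hAB hξ hs contDiff_const (fun _ => zero_le_one) s hc hp hq hQ (ρ := 1) (by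
      intro x hx
      exact (mul_inv_cancel₀ (dlam_pos hξ hs (show 0 < x by linarith [hx.1])).ne').le)
  have e1 : ∫ x in A..B, (1:ℝ) = 1 := by simp [hAB]
  rw [e1, mul_one] at h
  refine le_trans (le_of_eq ?_) h
  apply intervalIntegral.integral_congr
  intro x hx
  rw [Set.uIcc_of_le (by linarith)] at hx
  have hd := dlam_pos hξ hs (show 0 < x by linarith [hx.1])
  simp only [phi]
  field_simp

lemma markov {A B ξ : ℝ} (hA : 1 < A) (hAB : B - A = 1) (hξ : 0 < ξ) {s : ℕ → ℕ} (hs : ∀ n, 1 ≤ n → 1 ≤ s n) {q : ℝ → ℝ} {Q : ℝ}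
    (hc : Continuous q) (hp : ∀ x, q (x + 1) = q x) (hq : ∀ x, 0 ≤ q x)
    (hQ : ∫ x in (0:ℝ)..1, q x ≤ Q) (N : ℕ) :
    volume.real {x ∈ Set.Icc A B | 1 ≤ ∑ n ∈ Finset.Icc 1 N, q (lam ξ (s n) x)} ≤ N * (Q * (16 * ξ⁻¹ + 1)) := by
  have hle : A ≤ B := by linarith
  have hcs : Continuous fun x => ∑ n ∈ Finset.Icc 1 N, q (lam ξ (s n) x) :=
    continuous_finsetSum _ fun n _ => hc.comp (continuous_lam ξ _)
  have h1 := mul_meas_ge_le_integral_of_nonneg (μ := volume.restrict (Set.Icc A B)) 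
    (f := fun x => ∑ n ∈ Finset.Icc 1 N, q (lam ξ (s n) x))
    (Eventually.of_forall fun x => Finset.sum_nonneg fun n _ => hq _) (hcs.continuousOn.integrableOn_Icc) 1
  rw [one_mul, measureReal_restrict_apply (measurableSet_le measurable_const hcs.measurable)] at h1
  have e : {x | 1 ≤ ∑ n ∈ Finset.Icc 1 N, q (lam ξ (s n) x)} ∩ Set.Icc A B =
     {x ∈ Set.Icc A B | 1 ≤ ∑ n ∈ Finset.Icc 1 N, q (lam ξ (s n) x)} := by
    ext x; simp [and_comm]
  rw [e] at h1
  refine h1.trans ?_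
  rw [integral_Icc_eq_integral_Ioc, ← intervalIntegral.integral_of_le hle, intervalIntegral.integral_finsetSum
     (f := fun n x => q (lam ξ (s n) x)) (fun n _ => (hc.comp (continuous_lam ξ (s n))).intervalIntegrable _ _)]
  calc _ ≤ ∑ n ∈ Finset.Icc 1 N, Q * (16 * ξ⁻¹ + 1) := Finset.sum_le_sum fun n hn =>
        int_q hA hAB hξ (hs n (Finset.mem_Icc.1 hn).1) hc hp hq hQ
    _ = _ := by simp

lemma decomp_aux (u : ℕ → ℝ) (L i : ℕ) : ∑ n ∈ Finset.range (L + 2 * i * L), u (n + 1) = ∑ n ∈ Finset.range L, u (n + 1) +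
    (∑ j ∈ Finset.range i, ∑ r ∈ Finset.range L, u (L + 1 + 2 * j * L + r)) +
    ∑ j ∈ Finset.range i, ∑ r ∈ Finset.range L, u (2 * L + 1 + 2 * j * L + r) := by
  induction i with
  | zero => simp
  | succ i ih =>
    rw [show L + 2 * (i + 1) * L = (L + 2 * i * L) + L + L by ring, Finset.sum_range_add, Finset.sum_range_add, ih,
      Finset.sum_range_succ, Finset.sum_range_succ]
    have e1 : ∀ x, u (L + 2 * i * L + x + 1) = u (L + 1 + 2 * i * L + x) := fun x => by congr 1; ring
    have e2 : ∀ x, u (L + 2 * i * L + L + x + 1) = u (2 * L + 1 + 2 * i * L + x) := fun x => by congr 1; ring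
    simp only [e1, e2]
    ring

lemma abs_sum_le_two (u : ℕ → ℝ) (hu : ∀ n, |u n| ≤ 2) (n : ℕ) : |∑ k ∈ Finset.range n, u k| ≤ 2 * n := by
  refine (Finset.abs_sum_le_sum_abs _ _).trans ?_
  calc _ ≤ ∑ k ∈ Finset.range n, (2:ℝ) := Finset.sum_le_sum fun k _ => hu k
    _ = _ := by simp; ring

lemma decomp (u : ℕ → ℝ) (hu : ∀ n, |u n| ≤ 2) {L : ℕ} (hL : 1 ≤ L) (M : ℕ) : ∃ i, 2 * i * L ≤ M ∧
    |∑ n ∈ Finset.Icc 1 M, u n| ≤ 6 * L + |∑ j ∈ Finset.range i, ∑ r ∈ Finset.range L, u (L + 1 + 2 * j * L + r)| +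
    |∑ j ∈ Finset.range i, ∑ r ∈ Finset.range L, u (2 * L + 1 + 2 * j * L + r)| := by
  have e : ∑ n ∈ Finset.Icc 1 M, u n = ∑ n ∈ Finset.range M, u (n + 1) := by
    rw [Finset.range_eq_Ico, Finset.sum_Ico_add' u 0 M 1]
    rfl
  rw [e]
  by_cases hM : M < L
  · refine ⟨0, by simp, ?_⟩
    have := abs_sum_le_two (fun n => u (n + 1)) (fun n => hu _) M
    have h2 : (M:ℝ) ≤ L := by exact_mod_cast hM.le
    have h3 : (0:ℝ) ≤ L := by positivity
    simp
    linarith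
  · set i := (M - L) / (2 * L) with hi
    have hd := Nat.div_add_mod (M - L) (2 * L)
    have hr := Nat.mod_lt (M - L) (show 0 < 2 * L by omega)
    set k := (M - L) % (2 * L)
    rw [← hi] at hd
    have e2 : 2 * L * i = 2 * i * L := by ring
    have hMe : M = (L + 2 * i * L) + k := by omega
    refine ⟨i, by omega, ?_⟩
    rw [hMe, Finset.sum_range_add, decomp_aux]
    have b1 := abs_sum_le_two (fun n => u (n + 1)) (fun n => hu _) L
    have b2 := abs_sum_le_two (fun n => u (L + 2 * i * L + n + 1)) (fun n => hu _) k
    have hk : (k:ℝ) ≤ 2 * L := by exact_mod_cast hr.le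
    set a1 := ∑ n ∈ Finset.range L, u (n + 1)
    set a2 := ∑ n ∈ Finset.range k, u (L + 2 * i * L + n + 1)
    set a3 := ∑ j ∈ Finset.range i, ∑ r ∈ Finset.range L, u (L + 1 + 2 * j * L + r)
    set a4 := ∑ j ∈ Finset.range i, ∑ r ∈ Finset.range L, u (2 * L + 1 + 2 * j * L + r)
    have h1 := abs_add_le (a1 + a3 + a4) a2
    have h2 := abs_add_le (a1 + a3) a4
    have h3 := abs_add_le a1 a3
    linarith

lemma Sm.neg {g : ℝ → ℝ} (h : Sm g) : Sm (fun x => - g x) where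
  cd := h.cd.neg
  per := fun x => by simp [h.per]
  bd := fun x => by rw [abs_neg]; exact h.bd x
  mean := by rw [intervalIntegral.integral_neg, h.mean, neg_zero]
  var := by
    have : ∀ x, deriv (fun x => - g x) x = - deriv g x := fun x => deriv.fun_neg
    simp only [this, abs_neg]; exact h.var

set_option maxHeartbeats 4000000 in
lemma core {A B ξ θ : ℝ} (hA : 1 < A) (hAB : B - A = 1) (hξ : 0 < ξ) (hθ0 : 0 ≤ θ) (hθ1 : θ < 1) (hθ : θ ^ 2 = A⁻¹)
    {N L : ℕ} {z y ℓ : ℝ} (hz : z ^ 16 = N) (hz3 : 3 ≤ z) (hLz : L ≤ z) (hL : 1 ≤ L) (hℓ : 1 ≤ ℓ) (hℓz : ℓ ≤ z)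
    (hξN : ξ⁻¹ ≤ N) (hAL : (N:ℝ) ^ 9 ≤ A ^ L) (hy0 : 0 < y) (hy : 1 ≤ 2 * z * y)
    {s : ℕ → ℕ} (hs : StrictMono s) (hs1 : ∀ n, 1 ≤ n → 1 ≤ s n)
    {f : ℝ → ℝ} (hf : ∀ x, f (x + 1) = f x) (h0 : ∫ x in (0:ℝ)..1, f x = 0)
    (hv : eVariationOn f (Set.Icc (0:ℝ) 1) ≤ 2) (hσ : ∫ x in (0:ℝ)..1, f x ^ 2 = (y ^ 4) ^ 2) {γ : ℝ} (hγ : 1 ≤ γ) :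
    volume.real {x ∈ Set.Icc A B | ∃ M : ℕ, 1 ≤ M ∧ M ≤ N ∧
            119 * γ * (16 + 262 / (1 - θ)) * y * Real.sqrt (N * ℓ) ≤
              |∑ n ∈ Finset.Icc 1 M, f (lam ξ (s n) x)|} ≤
      (6 * (16 * ξ⁻¹ + 1) + 8 + 8 * Real.exp 1) * (Real.exp (-(γ * (ℓ / y ^ 2))) + ((N:ℝ) ^ 3)⁻¹) := by
  have hz0 : 0 < z := by linarith
  have hz1 : 1 ≤ z := by linarith
  have hN : (10:ℝ) ≤ N := by
    rw [← hz]
    calc (10:ℝ) ≤ 3 ^ 16 := by norm_num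
      _ ≤ z ^ 16 := by gcongr
  have hN0 : (0:ℝ) < N := by linarith
  set C₁ := 16 + 262 / (1 - θ) with hC₁
  have hC16 : 16 ≤ C₁ := by
    have : 0 ≤ 262 / (1 - θ) := div_nonneg (by norm_num) (by linarith)
    linarith
  set R := Real.sqrt (N * ℓ) with hR
  have hR2 : R ^ 2 = N * ℓ := Real.sq_sqrt (by positivity)
  have hR0 : 0 < R := Real.sqrt_pos.2 (by positivity)
  have hRz : z ^ 8 ≤ R := by
    apply Real.le_sqrt_of_sq_le
    rw [← pow_mul, hz]; nlinarith
  have hRz2 : R ≤ z ^ 8 * ℓ := by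
    rw [hR]; apply Real.sqrt_le_iff.2
    refine ⟨by positivity, ?_⟩
    rw [mul_pow, ← pow_mul, hz]
    have : ℓ ≤ ℓ ^ 2 := by nlinarith
    gcongr
  have hyi : y⁻¹ ≤ 2 * z := by
    rw [inv_le_iff_one_le_mul₀ hy0]; linarith
  set κ := ℓ / (y ^ 3 * R) with hκ
  have hκ0 : 0 < κ := by positivity
  set t := 119 * γ * C₁ * y * R with ht
  set P := ℓ / y ^ 2 with hP
  have hP0 : 0 < P := by positivity
  have hκt : κ * t = 119 * γ * C₁ * P := by rw [hκ, ht, hP]; field_simp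
  have hκN : κ ^ 2 * (2 * y ^ 4) * N = 2 * P := by
    rw [hκ, hP, div_pow, mul_pow, hR2]; field_simp
  have ht0 : 0 < t := by positivity
  have htL : 7 * (L:ℝ) ≤ t / 2 := by
    have h1 : z ^ 2 ≤ z ^ 8 := pow_le_pow_right₀ hz1 (by norm_num)
    have h2 : (L:ℝ) ≤ y * R * 2 := by
      calc (L:ℝ) ≤ z := hLz
        _ ≤ z * (2 * z * y) := le_mul_of_one_le_right hz0.le hy
        _ = z ^ 2 * y * 2 := by ring
        _ ≤ R * y * 2 := by gcongr; linarith
        _ = _ := by ring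
    have h3 : 16 * (y * R) ≤ γ * C₁ * (y * R) := by
      have : 16 ≤ γ * C₁ := hC16.trans (le_mul_of_one_le_left (by linarith) hγ)
      gcongr
    have h4 : t = 119 * (γ * C₁ * (y * R)) := by rw [ht]; ring
    rw [h4]
    have : 0 < y * R := by positivity
    linarith
  have hκL : κ * (2 * L) ≤ 1 := by
    have e : κ * (2 * L) = (y⁻¹) ^ 3 * ℓ * (2 * L) / R := by rw [hκ]; field_simp
    rw [e, div_le_one hR0]
    calc (y⁻¹) ^ 3 * ℓ * (2 * L) ≤ (2 * z) ^ 3 * z * (2 * z) := by gcongr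
      _ = 16 * z ^ 5 := by ring
      _ ≤ z ^ 3 * z ^ 5 := by
          have : (16:ℝ) ≤ z ^ 3 := by
            calc (16:ℝ) ≤ 3 ^ 3 := by norm_num
              _ ≤ z ^ 3 := by gcongr
          gcongr
      _ = z ^ 8 := by ring
      _ ≤ R := hRz
  set h : ℝ := ((N:ℝ) ^ 4)⁻¹ with hh
  have hh0 : 0 < h := by positivity
  obtain ⟨hb, hi2, hsm⟩ := smoothing hf h0 hv
  obtain ⟨g, q, hg, hMg, hg2, hcq, hpq, hfq, hIq⟩ := hsm h hh0
  have hq0 : ∀ x, 0 ≤ q x := fun x => (abs_nonneg _).trans (hfq x)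
  have hS : ∫ x in (0:ℝ)..1, g x ^ 2 ≤ (2 * y ^ 4) ^ 2 := by
    refine hg2.trans ?_
    rw [hσ]
    have h1 : 1 ≤ (2 * z * y) ^ 8 := one_le_pow₀ hy
    have h2 : 24 * h ≤ 3 * y ^ 8 := by
      rw [hh, ← hz]
      rw [← div_eq_mul_inv, div_le_iff₀ (by positivity)]
      have e : 3 * y ^ 8 * (z ^ 16) ^ 4 = (2 * z * y) ^ 8 * (3 * (z ^ 56 / 256)) := by ring
      rw [e]
      have h3 : (2048:ℝ) ≤ z ^ 56 := by
        calc (2048:ℝ) ≤ 3 ^ 8 := by norm_num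
          _ ≤ z ^ 8 := pow_le_pow_left₀ (by norm_num) hz3 8
          _ ≤ z ^ 56 := pow_le_pow_right₀ hz1 (by norm_num)
      have h4 : (24:ℝ) ≤ 3 * (z ^ 56 / 256) := by linarith
      exact h4.trans (le_mul_of_one_le_left (by positivity) h1)
    have e1 : (y ^ 4) ^ 2 = y ^ 8 := by ring
    have e2 : (2 * y ^ 4) ^ 2 = 4 * y ^ 8 := by ring
    linarith
  have hδκ : (N:ℝ)⁻¹ ≤ κ * (2 * y ^ 4) := by
    have e : κ * (2 * y ^ 4) = 2 * y * ℓ / R := by rw [hκ]; field_simp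
    rw [e, inv_eq_one_div, div_le_div_iff₀ hN0 hR0, one_mul]
    calc R ≤ z ^ 8 * ℓ := hRz2
      _ ≤ (z ^ 8 * ℓ) * (2 * z * y) := le_mul_of_one_le_right (by positivity) hy
      _ = 2 * y * ℓ * z ^ 9 := by ring
      _ ≤ 2 * y * ℓ * N := by
          rw [← hz]
          have : z ^ 9 ≤ z ^ 16 := pow_le_pow_right₀ hz1 (by norm_num)
          gcongr
  have hlog : Real.log N ≤ N := (Real.log_le_sub_one_of_pos hN0).trans (by linarith)
  have hlog0 : 0 ≤ Real.log N := Real.log_nonneg (by linarith)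
  have hA9 : (N:ℝ) ^ 8 ≤ (N:ℝ)⁻¹ * A ^ L := by
    calc (N:ℝ) ^ 8 = (N:ℝ)⁻¹ * N ^ 9 := by field_simp
      _ ≤ _ := by gcongr
  have hδa : ξ⁻¹ ≤ (N:ℝ)⁻¹ * A ^ L := by
    refine le_trans (hξN.trans ?_) hA9
    exact le_self_pow₀ (by linarith) (by norm_num)
  have hδb : ((N:ℝ) * (4 * Real.log N) + 1) * (κ * (N * L * (4 / h))) ≤ (N:ℝ)⁻¹ * A ^ L := by
    refine le_trans ?_ hA9
    have e : κ * (N * L * (4 / h)) = (κ * (2 * L)) * (2 * N ^ 5) := by rw [hh]; field_simp; ring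
    rw [e]
    calc ((N:ℝ) * (4 * Real.log N) + 1) * ((κ * (2 * L)) * (2 * N ^ 5)) ≤ ((N:ℝ) * (4 * N) + N * N) * (1 * (2 * (N:ℝ) ^ 5)) := by
          gcongr
          exact one_le_mul_of_one_le_of_one_le (by linarith) (by linarith)
      _ = 10 * (N:ℝ) ^ 7 := by ring
      _ ≤ N * (N:ℝ) ^ 7 := by gcongr
      _ = _ := by ring
  have hKm : (N:ℝ) * Real.exp (-(4 * Real.log N)) = ((N:ℝ)^3)⁻¹ := by
    rw [Real.exp_neg, show (4:ℝ) * Real.log N = ((4:ℕ):ℝ) * Real.log N by norm_num, Real.exp_nat_mul, Real.exp_log hN0]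
    field_simp
  -- the four chains
  have hch : ∀ g', Sm g' → (∀ x, |deriv g' x| ≤ 4 / h) → (∫ x in (0:ℝ)..1, g' x ^ 2 ≤ (2 * y ^ 4) ^ 2) → ∀ o, L + 1 ≤ o →
      volume.real {x ∈ Set.Icc A B | ∃ i, 1 ≤ i ∧ i ≤ N ∧ 
      γ * P ≤ Tc ξ κ (C₁ * (κ ^ 2 * (2 * y ^ 4) * L)) g' s o L i x} ≤ 2 * (((N:ℝ)^3)⁻¹ + Real.exp (1 - γ * P)) := by
    intro g' hg' hM' hS' o ho
    rw [← hKm]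
    exact chain hA hAB hξ hg' (by positivity) hS' hs hM' (inv_nonneg.2 hN0.le) (inv_le_one_of_one_le₀ (by linarith)) ho hL hθ0 hθ1 hθ
      hκ0.le hκL hδκ (by positivity) hδa hδb
  have hgn := hg.neg
  have hMn : ∀ x, |deriv (fun x => - g x) x| ≤ 4 / h := fun x => by
    rw [deriv.fun_neg, abs_neg]; exact hMg x
  have hSn : ∫ x in (0:ℝ)..1, (fun x => - g x) x ^ 2 ≤ (2 * y ^ 4) ^ 2 := by simpa using hS
  have c1 := hch g hg hMg hS (L + 1) le_rfl
  have c2 := hch g hg hMg hS (2 * L + 1) (by omega)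
  have c3 := hch _ hgn hMn hSn (L + 1) le_rfl
  have c4 := hch _ hgn hMn hSn (2 * L + 1) (by omega)
  have c0 := markov hA hAB hξ hs1 hcq hpq hq0 hIq N
  set E0 := {x ∈ Set.Icc A B | 1 ≤ ∑ n ∈ Finset.Icc 1 N, q (lam ξ (s n) x)} with hE0
  set F : (ℝ → ℝ) → ℕ → Set ℝ := fun g' o => {x ∈ Set.Icc A B | ∃ i, 1 ≤ i ∧ i ≤ N ∧ 
      γ * P ≤ Tc ξ κ (C₁ * (κ ^ 2 * (2 * y ^ 4) * L)) g' s o L i x} with hF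
  have hkey : ∀ i : ℕ, 2 * i * L ≤ N → γ * P ≤ κ * (t / 4) - i * (C₁ * (κ ^ 2 * (2 * y ^ 4) * L)) := by
    intro i hi
    have h1 : 2 * (i:ℝ) * L ≤ N := by exact_mod_cast hi
    have h2 : i * (C₁ * (κ ^ 2 * (2 * y ^ 4) * L)) ≤ C₁ * P := by
      calc i * (C₁ * (κ ^ 2 * (2 * y ^ 4) * L)) = C₁ * (κ ^ 2 * (2 * y ^ 4)) * (2 * i * L) / 2 := by ring
        _ ≤ C₁ * (κ ^ 2 * (2 * y ^ 4)) * N / 2 := by gcongr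
        _ = C₁ * (κ ^ 2 * (2 * y ^ 4) * N) / 2 := by ring
        _ = C₁ * P := by rw [hκN]; ring
    have h3 : κ * (t / 4) = 119 * γ * C₁ * P / 4 := by rw [← hκt]; ring
    have h4 : C₁ * P ≤ γ * (C₁ * P) := le_mul_of_one_le_left (by positivity) hγ
    have h5 : γ * P * 16 ≤ γ * P * C₁ := by gcongr
    have h6 : 0 < γ * P := by positivity
    rw [h3]
    linarith
  have hpick : ∀ g' o, ∀ x ∈ Set.Icc A B, ∀ i : ℕ, 2 * i * L ≤ N → 
      t / 4 ≤ ∑ j ∈ Finset.range i, ∑ r ∈ Finset.range L, g' (lam ξ (s (o + 2 * j * L + r)) x) → x ∈ F g' o := by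
    intro g' o x hx i hi hsum
    refine ⟨hx, i, ?_, ?_, ?_⟩
    · rcases Nat.eq_zero_or_pos i with h | h
      · subst h; simp at hsum; linarith
      · exact h
    · refine le_trans ?_ hi
      calc i = 1 * i * 1 := by ring
        _ ≤ 2 * i * L := by gcongr; norm_num
    · refine (hkey i hi).trans ?_
      unfold Tc
      have := mul_le_mul_of_nonneg_left hsum hκ0.le
      linarith
  have hsub : {x ∈ Set.Icc A B | ∃ M : ℕ, 1 ≤ M ∧ M ≤ N ∧ t ≤ |∑ n ∈ Finset.Icc 1 M, f (lam ξ (s n) x)|} ⊆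
      E0 ∪ ((F g (L + 1) ∪ F g (2 * L + 1)) ∪ (F (fun x => - g x) (L + 1) ∪ F (fun x => - g x) (2 * L + 1))) := by
    rintro x ⟨hx, M, hM1, hMN, hM⟩
    by_cases hE : x ∈ E0
    · exact Or.inl hE
    right
    have hE' : ∑ n ∈ Finset.Icc 1 N, q (lam ξ (s n) x) < 1 := by
      by_contra hcon
      exact hE ⟨hx, not_lt.1 hcon⟩
    have hdiff : |∑ n ∈ Finset.Icc 1 M, f (lam ξ (s n) x) - ∑ n ∈ Finset.Icc 1 M, g (lam ξ (s n) x)| ≤ 1 := by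
      rw [← Finset.sum_sub_distrib]
      refine (Finset.abs_sum_le_sum_abs _ _).trans (le_trans ?_ hE'.le)
      refine (Finset.sum_le_sum fun n _ => hfq _).trans ?_
      exact Finset.sum_le_sum_of_subset_of_nonneg (Finset.Icc_subset_Icc_right hMN) fun n _ _ => hq0 _
    obtain ⟨i, hi, hdec⟩ := decomp (fun n => g (lam ξ (s n) x)) (fun n => hg.bd _) hL M
    have hiN := hi.trans hMN
    have hLr : (1:ℝ) ≤ L := by exact_mod_cast hL
    have htri := abs_sub_abs_le_abs_sub (∑ n ∈ Finset.Icc 1 M, f (lam ξ (s n) x)) (∑ n ∈ Finset.Icc 1 M, g (lam ξ (s n) x))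
    have hor : t / 4 ≤ |∑ j ∈ Finset.range i, ∑ r ∈ Finset.range L, g (lam ξ (s (L + 1 + 2 * j * L + r)) x)| ∨ 
      t / 4 ≤ |∑ j ∈ Finset.range i, ∑ r ∈ Finset.range L, g (lam ξ (s (2 * L + 1 + 2 * j * L + r)) x)| := by
      by_contra hcon
      push Not at hcon
      linarith [hcon.1, hcon.2]
    rcases hor with h | h <;> rcases le_abs.1 h with h | h
    · exact Or.inl (Or.inl (hpick _ _ x hx i hiN h))
    · exact Or.inr (Or.inl (hpick _ _ x hx i hiN (by simpa using h)))
    · exact Or.inl (Or.inr (hpick _ _ x hx i hiN h))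
    · exact Or.inr (Or.inr (hpick _ _ x hx i hiN (by simpa using h)))
  have hfinIcc : volume (Set.Icc A B) ≠ ⊤ := by simp
  have hsubI : E0 ∪ ((F g (L + 1) ∪ F g (2 * L + 1)) ∪ (F (fun x => - g x) (L + 1) ∪ F (fun x => - g x) (2 * L + 1))) ⊆ Set.Icc A B := by
    rintro x (h | ((h | h) | (h | h)))
    all_goals exact h.1
  have hmono := measureReal_mono hsub (measure_ne_top_of_subset hsubI hfinIcc)
  refine hmono.trans ?_
  have u1 := measureReal_union_le (μ := volume) E0 ((F g (L + 1) ∪ F g (2 * L + 1)) ∪ (F (fun x => - g x) (L + 1) ∪ F (fun x => - g x) (2 * L + 1)))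
  have u2 := measureReal_union_le (μ := volume) (F g (L + 1) ∪ F g (2 * L + 1)) (F (fun x => - g x) (L + 1) ∪ F (fun x => - g x) (2 * L + 1))
  have u3 := measureReal_union_le (μ := volume) (F g (L + 1)) (F g (2 * L + 1))
  have u4 := measureReal_union_le (μ := volume) (F (fun x => - g x) (L + 1)) (F (fun x => - g x) (2 * L + 1))
  have hexp : Real.exp (1 - γ * P) = Real.exp 1 * Real.exp (-(γ * P)) := by rw [← Real.exp_add]; congr 1
  have hNh : N * (6 * h * (16 * ξ⁻¹ + 1)) = 6 * (16 * ξ⁻¹ + 1) * ((N:ℝ)^3)⁻¹ := by rw [hh]; field_simp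
  rw [hNh] at c0
  rw [hexp] at c1 c2 c3 c4
  have p1 : 0 < Real.exp (-(γ * P)) := Real.exp_pos _
  have p2 : 0 < ((N:ℝ)^3)⁻¹ := by positivity
  have p3 : 0 < Real.exp 1 := Real.exp_pos _
  have p4 : 0 < 6 * (16 * ξ⁻¹ + 1) := by positivity
  have p5 := mul_pos p4 p1
  have p6 := mul_pos p3 p2
  have ex : (6 * (16 * ξ⁻¹ + 1) + 8 + 8 * Real.exp 1) * (Real.exp (-(γ * P)) + ((N:ℝ) ^ 3)⁻¹) =
    6 * (16 * ξ⁻¹ + 1) * Real.exp (-(γ * P)) + 6 * (16 * ξ⁻¹ + 1) * ((N:ℝ) ^ 3)⁻¹ + 8 * Real.exp (-(γ * P)) + 8 * ((N:ℝ) ^ 3)⁻¹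
     + 8 * (Real.exp 1 * Real.exp (-(γ * P))) + 8 * (Real.exp 1 * ((N:ℝ) ^ 3)⁻¹) := by ring
  rw [ex]
  linarith

lemma one_le_plog (x : ℝ) : 1 ≤ plog x := le_max_left _ _

lemma eventually_params {A ξ : ℝ} (hA : 1 < A) : ∃ N₀ : ℕ, ∀ N : ℕ, N₀ ≤ N → ∃ (L : ℕ) (z : ℝ),
    z ^ 16 = N ∧ z ^ 4 * (N:ℝ) ^ (-(1/4) : ℝ) = 1 ∧ 3 ≤ z ∧ L ≤ z ∧ 1 ≤ L ∧ plog (plog N) ≤ z ∧ ξ⁻¹ ≤ N ∧ (N:ℝ) ^ 9 ≤ A ^ L := by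
  have hlA : 0 < Real.log A := Real.log_pos hA
  have ho := (isLittleO_log_rpow_atTop (r := 1/16) (by norm_num)).comp_tendsto (tendsto_natCast_atTop_atTop (R := ℝ))
  have hc : 0 < min (1/2) (Real.log A / 18) := lt_min (by norm_num) (by positivity)
  have h1 := ho.bound hc
  have h2 : ∀ᶠ N : ℕ in atTop, 3 ≤ (N:ℝ) ^ (1/16 : ℝ) :=
    ((tendsto_rpow_atTop (y := 1/16) (by norm_num)).comp tendsto_natCast_atTop_atTop).eventually_ge_atTop 3
  have h3 : ∀ᶠ N : ℕ in atTop, ξ⁻¹ ≤ (N:ℝ) := tendsto_natCast_atTop_atTop.eventually_ge_atTop _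
  have h4 : ∀ᶠ N : ℕ in atTop, (3:ℝ) ≤ (N:ℝ) := tendsto_natCast_atTop_atTop.eventually_ge_atTop _
  obtain ⟨N₀, hN₀⟩ := eventually_atTop.1 (h1.and (h2.and (h3.and h4)))
  refine ⟨N₀, fun N hN => ?_⟩
  obtain ⟨e1, e2, e3, e4⟩ := hN₀ N hN
  have hN0 : (0:ℝ) < N := by linarith
  have hlog1 : 1 ≤ Real.log N := by
    rw [Real.le_log_iff_exp_le hN0]
    linarith [Real.exp_one_lt_d9]
  set z := (N:ℝ) ^ (1/16 : ℝ) with hz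
  simp only [Function.comp] at e1
  rw [Real.norm_of_nonneg (by linarith), Real.norm_of_nonneg (by positivity), ← hz] at e1
  have hz0 : 0 < z := by linarith
  have a1 : Real.log N ≤ z / 2 := by
    refine e1.trans ?_
    have := mul_le_mul_of_nonneg_right (min_le_left (1/2) (Real.log A / 18)) hz0.le
    linarith
  have a2 : 9 * Real.log N / Real.log A ≤ z / 2 := by
    rw [div_le_iff₀ hlA]
    have := mul_le_mul_of_nonneg_right (min_le_right (1/2) (Real.log A / 18)) hz0.le
    linarith
  refine ⟨⌈9 * Real.log N / Real.log A⌉₊, z, ?_, ?_, e2, ?_, ?_, ?_, e3, ?_⟩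
  · rw [hz, ← Real.rpow_natCast, ← Real.rpow_mul hN0.le]; norm_num
  · rw [hz, ← Real.rpow_natCast, ← Real.rpow_mul hN0.le, ← Real.rpow_add hN0]; norm_num
  · have := Nat.ceil_lt_add_one (a := 9 * Real.log N / Real.log A) (by positivity)
    linarith
  · exact Nat.one_le_ceil_iff.2 (by positivity)
  · have : plog N = Real.log N := max_eq_right hlog1
    rw [this]
    refine max_le (by linarith) ?_
    have := Real.log_le_sub_one_of_pos (show 0 < Real.log N by linarith)
    linarith
  · have := Nat.le_ceil (9 * Real.log N / Real.log A)
    rw [div_le_iff₀ hlA] at this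
    rw [← Real.log_le_log_iff (by positivity) (by positivity), Real.log_pow, Real.log_pow]
    exact_mod_cast this

theorem stmt11 (ξ A B : ℝ) (hξ : 0 < ξ) (hA : 1 < A) (hAB : B - A = 1) :
    ∃ (c C : ℝ) (N₀ : ℕ), 1 ≤ c ∧ 0 < C ∧
      ∀ N : ℕ, N₀ ≤ N →
      ∀ s : ℕ → ℕ, StrictMono s → (∀ n, 1 ≤ n → 1 ≤ s n) →
      ∀ f : ℝ → ℝ, (∀ x : ℝ, f (x + 1) = f x) → (∫ x in (0:ℝ)..1, f x) = 0 →
        eVariationOn f (Set.Icc (0:ℝ) 1) ≤ 2 →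
        (N : ℝ) ^ (-(1/4) : ℝ) / Real.sqrt 2 ≤ fnorm A B f →
      ∀ γ : ℝ, 1 ≤ γ →
        (volume {x ∈ Set.Icc A B | ∃ M : ℕ, 1 ≤ M ∧ M ≤ N ∧
            119 * γ * c * fnorm A B f ^ ((1:ℝ)/4) * Real.sqrt (N * plog (plog N)) ≤
              |∑ n ∈ Finset.Icc 1 M, f (ξ * x ^ s n)|}).toReal ≤
          C * (Real.exp (-γ * fnorm A B f ^ (-(1/2) : ℝ) * plog (plog N))
              + (N : ℝ) ^ (-3 : ℤ)) := by
  have hA0 : 0 < A := by linarith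
  obtain ⟨N₀, hN₀⟩ := eventually_params (ξ := ξ) hA
  set θ := (Real.sqrt A)⁻¹ with hθd
  have hsA : 1 < Real.sqrt A := by rw [Real.lt_sqrt (by norm_num)]; linarith
  have hθ0 : 0 ≤ θ := by positivity
  have hθ1 : θ < 1 := inv_lt_one_of_one_lt₀ hsA
  have hθ : θ ^ 2 = A⁻¹ := by rw [hθd, inv_pow, Real.sq_sqrt hA0.le]
  refine ⟨16 + 262 / (1 - θ), 6 * (16 * ξ⁻¹ + 1) + 8 + 8 * Real.exp 1, N₀, ?_, by positivity, ?_⟩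
  · have : 0 ≤ 262 / (1 - θ) := div_nonneg (by norm_num) (by linarith)
    linarith
  intro N hN s hs hs1 f hf h0 hv hσ γ hγ
  obtain ⟨L, z, hz, hz4, hz3, hLz, hL, hℓz, hξN, hAL⟩ := hN₀ N hN
  have hz0 : 0 < z := by linarith
  have hN0 : (0:ℝ) < N := by rw [← hz]; positivity
  have h2 : 0 < Real.sqrt 2 := Real.sqrt_pos.2 (by norm_num)
  have h22 : Real.sqrt 2 ≤ 2 := by rw [Real.sqrt_le_left (by norm_num)]; norm_num
  set σ := fnorm A B f with hσd
  have hσ0 : 0 < σ := lt_of_lt_of_le (by positivity) hσ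
  have hsq : ∫ x in (0:ℝ)..1, f x ^ 2 = σ ^ 2 := by
    have hp : Function.Periodic (fun x => f x ^ 2) 1 := fun x => by simp only [hf]
    have e := hp.intervalIntegral_add_eq A 0
    rw [zero_add, show A + 1 = B by linarith] at e
    rw [hσd, fnorm, Real.sq_sqrt, e]
    exact intervalIntegral.integral_nonneg (by linarith) fun x _ => sq_nonneg _
  set y := σ ^ ((1:ℝ)/4) with hyd
  have hy0 : 0 < y := Real.rpow_pos_of_pos hσ0 _
  have hy4 : y ^ 4 = σ := by
    rw [hyd, ← Real.rpow_natCast, ← Real.rpow_mul hσ0.le]; norm_num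
  have hy2 : σ ^ (-(1/2) : ℝ) = (y ^ 2)⁻¹ := by
    rw [hyd, ← Real.rpow_natCast, ← Real.rpow_mul hσ0.le, ← Real.rpow_neg hσ0.le]; norm_num
  have hy : 1 ≤ 2 * z * y := by
    rw [← one_le_pow_iff_of_nonneg (by positivity) (show 4 ≠ 0 by norm_num)]
    have e : (2 * z * y) ^ 4 = 16 * z ^ 4 * σ := by rw [← hy4]; ring
    rw [e]
    rw [div_le_iff₀ h2] at hσ
    have k1 : 1 ≤ z ^ 4 * (σ * 2) := by
      rw [← hz4]
      have : σ * Real.sqrt 2 ≤ σ * 2 := by gcongr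
      have := hσ.trans this
      gcongr
    linarith
  have key := core hA hAB hξ hθ0 hθ1 hθ hz hz3 hLz hL (one_le_plog _) hℓz hξN hAL hy0 hy hs hs1 hf h0 hv
    (by rw [hsq, hy4]) hγ
  have e1 : -γ * σ ^ (-(1/2) : ℝ) * plog (plog N) = -(γ * (plog (plog N) / y ^ 2)) := by
    rw [hy2]; ring
  have e2 : (N:ℝ) ^ (-3 : ℤ) = ((N:ℝ) ^ 3)⁻¹ := by
    rw [zpow_neg]; norm_cast
  rw [e1, e2]
  exact key
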